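/- arXiv:1208.5857 — 11 statements merged into one kernel-verified Lean document; each statement's English description precedes it below -/
import Mathlib

section
/- Let G be a group and let M, L be elements of G that commute (M·L = L·M). Let p and q be coprime integers such that M^p · L^q = 1 in G. Then there exists an element k ∈ G such that M = k^q and L = k^{-p}. -/
/-- Lemma 3.1 of the paper, cf. Jun Lemma 8, RSS Lemma 3.4.
If `M` and `L` commute in a group `G`, `p` and `q` are coprime integers, and
`M ^ p * L ^ q = 1`, then there exists `k ∈ G` with `M = k ^ q` and `L = k ^ (-p)`. -/
theorem exists_root_of_commuting_meridian_longitude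
    {G : Type*} [Group G] (M L : G) (hcomm : M * L = L * M)
    (p q : ℤ) (hpq : IsCoprime p q) (hrel : M ^ p * L ^ q = 1) :
    ∃ k : G, M = k ^ q ∧ L = k ^ (-p) := by
  obtain ⟨a, b, hab⟩ := hpq
  have hc : Commute M L := hcomm
  have hL : L ^ q = M ^ (-p) := by
    rw [zpow_neg]; exact (inv_eq_of_mul_eq_one_right hrel).symm
  have hM : M ^ p = L ^ (-q) := by
    rw [zpow_neg]; exact eq_inv_of_mul_eq_one_left hrel
  have hk : Commute (M ^ b) (L ^ (-a)) := hc.zpow_zpow b (-a)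
  refine ⟨M ^ b * L ^ (-a), ?_, ?_⟩
  · have h : L ^ (-a * q) = M ^ (a * p) := by
      rw [mul_comm, zpow_mul, hL, ← zpow_mul]
      congr 1; ring
    rw [hk.mul_zpow, ← zpow_mul, ← zpow_mul, h, ← zpow_add, add_comm, hab, zpow_one]
  · have h : M ^ (b * -p) = L ^ (b * q) := by
      rw [show b * -p = p * -b by ring, zpow_mul, hM, ← zpow_mul]
      congr 1; ring
    rw [hk.mul_zpow, ← zpow_mul, ← zpow_mul, h, ← zpow_add,
      show b * q + -a * -p = a * p + b * q by ring, hab, zpow_one]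
end

section
/- Let s ≥ 3 be an integer and let p, q be coprime integers with q > 0 and p - (4s+7)q ≥ 0. Let P be a partially ordered set on which G_s(p,q) acts (on the right) by order automorphisms, and let k ∈ G_s(p,q) satisfy M = k^q and L = k^{-p}. If x ∈ P satisfies x·k = x and the elements x and x·l are comparable (i.e. x < x·l, x·l < x, or x = x·l), then x·g = x for every g ∈ G_s(p,q). -/
/-- The free-group word `c` (first generator). -/
def cw : FreeGroup (Fin 2) := FreeGroup.of 0

/-- The free-group word `l` (second generator). -/
def lw : FreeGroup (Fin 2) := FreeGroup.of 1

/-- The relator `c l c l⁻¹ c⁻¹ l⁻ˢ c⁻¹ l⁻¹ c l c l^(s-1)` of the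
knot group of the `(-2,3,2s+1)`-pretzel knot. -/
def pretzelRel (s : ℤ) : FreeGroup (Fin 2) :=
  cw * lw * cw * lw⁻¹ * cw⁻¹ * lw ^ (-s) * cw⁻¹ * lw⁻¹ * cw * lw * cw * lw ^ (s - 1)

/-- The meridian word `M = c`. -/
def Mw : FreeGroup (Fin 2) := cw

/-- The longitude word `L = c^{-(2s-2)} l c l^s c l^s c l c^{-(2s+9)}`. -/
def Lw (s : ℤ) : FreeGroup (Fin 2) :=
  cw ^ (-(2 * s - 2)) * lw * cw * lw ^ s * cw * lw ^ s * cw * lw * cw ^ (-(2 * s + 9))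

/-- `G_s`, the knot group of the `(-2,3,2s+1)`-pretzel knot. -/
abbrev Gs (s : ℤ) := PresentedGroup ({pretzelRel s} : Set (FreeGroup (Fin 2)))

/-- `G_s(p,q)`, the fundamental group of `p/q`-surgery on the `(-2,3,2s+1)`-pretzel knot. -/
abbrev Gspq (s p q : ℤ) :=
  PresentedGroup ({pretzelRel s, Mw ^ p * Lw s ^ q} : Set (FreeGroup (Fin 2)))

/-- The core of the longitude word, up to powers of `c`. -/
theorem aux_word {G : Type*} [Group G] (f : FreeGroup (Fin 2) →* G) (n : ℕ) :
    f lw * (f cw * f lw ^ n * f cw * f lw ^ n * f cw * f lw) =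
      f cw ^ (2 * (n : ℤ) - 2) * f (Lw n) * f cw ^ (2 * (n : ℤ) + 9) := by
  simp only [Lw, map_mul, map_zpow, map_pow, zpow_natCast]
  group

/-- If `x ≤ x·l`, `x·c = x` and `x` is fixed by a positive word starting with `l`, then `x·l = x`. -/
theorem aux_fix {G P : Type*} [Group G] [PartialOrder P] (act : P → G → P)
    (act_one : ∀ x : P, act x 1 = x)
    (act_mul : ∀ (x : P) (g h : G), act x (g * h) = act (act x g) h)
    (act_le : ∀ g : G, ∀ x y : P, x ≤ y ↔ act x g ≤ act y g)
    (x : P) (c l : G) (n : ℕ) (hc : act x c = x)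
    (hw : act x (l * (c * l ^ n * c * l ^ n * c * l)) = x) (hl : x ≤ act x l) :
    act x l = x := by
  have hm : ∀ g h : G, x ≤ act x g → x ≤ act x h → x ≤ act x (g * h) := by
    intro g h hg hh
    rw [act_mul]
    exact hh.trans ((act_le h _ _).1 hg)
  have hn : x ≤ act x (l ^ n) := by
    induction n with
    | zero => simp [act_one]
    | succ m ih =>
      clear hw ih
      induction m with
      | zero => simpa using hl
      | succ m ih => rw [pow_succ]; exact hm _ _ ih hl
  have hc' : x ≤ act x c := hc.ge
  have hr := hm _ _ (hm _ _ (hm _ _ (hm _ _ (hm _ _ hc' hn) hc') hn) hc') hl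
  rw [act_mul] at hw
  refine le_antisymm ?_ hl
  rw [act_le (c * l ^ n * c * l ^ n * c * l), hw]
  exact hr

/-- Lemma 3.3(1) of the paper, cf. Jun Lemma 15, RSS Lemma 3.5.
Suppose `q > 0`, `p - (4s+7)q ≥ 0`, and `G_s(p,q)` acts on the right on a
partially ordered set `P` by order automorphisms.  If `x·k = x` and `x`, `x·l`
are comparable, then `x` is fixed by every element of `G_s(p,q)`. -/
theorem fixed_point_of_k_fixed (s p q : ℤ) (hs : 3 ≤ s) (hpq : IsCoprime p q)
    (hq : 0 < q) (hslope : 0 ≤ p - (4 * s + 7) * q)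
    {P : Type*} [PartialOrder P]
    (act : P → Gspq s p q → P)
    (act_one : ∀ x : P, act x 1 = x)
    (act_mul : ∀ (x : P) (g h : Gspq s p q), act x (g * h) = act (act x g) h)
    (act_le : ∀ g : Gspq s p q, ∀ x y : P, x ≤ y ↔ act x g ≤ act y g)
    (k : Gspq s p q)
    (hM : PresentedGroup.mk _ Mw = k ^ q)
    (hL : PresentedGroup.mk _ (Lw s) = k ^ (-p))
    (x : P) (hxk : act x k = x)
    (hcomp : x < act x (PresentedGroup.mk _ lw) ∨
      act x (PresentedGroup.mk _ lw) < x ∨ x = act x (PresentedGroup.mk _ lw)) :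
    ∀ g : Gspq s p q, act x g = x := by
  have act_inv : ∀ g, act x g = x → act x g⁻¹ = x := by
    intro g hg
    conv_lhs => rw [← hg]
    rw [← act_mul, mul_inv_cancel, act_one]
  let H : Subgroup (Gspq s p q) :=
    { carrier := {g | act x g = x}
      one_mem' := act_one x
      mul_mem' := by
        intro a b ha hb
        change act x (a * b) = x
        rw [act_mul, show act x a = x from ha]
        exact hb
      inv_mem' := fun {a} ha => act_inv a ha }
  have hk : k ∈ H := hxk
  have hcH : (PresentedGroup.mk _ cw : Gspq s p q) ∈ H := by
    have h : (PresentedGroup.mk _ Mw : Gspq s p q) ∈ H := hM ▸ H.zpow_mem hk q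
    exact h
  have hLH : (PresentedGroup.mk _ (Lw s) : Gspq s p q) ∈ H := hL ▸ H.zpow_mem hk (-p)
  obtain ⟨n, rfl⟩ : ∃ n : ℕ, s = n := ⟨s.toNat, by omega⟩
  set c : Gspq n p q := PresentedGroup.mk _ cw with hcdef
  set l : Gspq n p q := PresentedGroup.mk _ lw with hldef
  have hw : l * (c * l ^ n * c * l ^ n * c * l) ∈ H := by
    have e : l * (c * l ^ n * c * l ^ n * c * l) =
        c ^ (2 * (n : ℤ) - 2) * PresentedGroup.mk _ (Lw n) * c ^ (2 * (n : ℤ) + 9) := by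
      exact aux_word (PresentedGroup.mk _) n
    rw [e]
    exact H.mul_mem (H.mul_mem (H.zpow_mem hcH _) hLH) (H.zpow_mem hcH _)
  have hlH : l ∈ H := by
    rcases hcomp with h | h | h
    · exact aux_fix act act_one act_mul act_le x c l n hcH hw h.le
    · exact aux_fix (P := Pᵒᵈ) act act_one act_mul (fun g x y => act_le g y x) x c l n hcH hw h.le
    · exact h.symm
  intro g
  change g ∈ H
  have htop : Subgroup.closure (Set.range (PresentedGroup.of
      (rels := {pretzelRel n, Mw ^ p * Lw n ^ q}))) ≤ H := by
    rw [Subgroup.closure_le]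
    rintro _ ⟨i, rfl⟩
    fin_cases i
    · exact hcH
    · exact hlH
  rw [PresentedGroup.closure_range_of] at htop
  exact htop (Subgroup.mem_top g)
end

section
/- Let s ≥ 3 be an integer and let p, q be coprime integers with q > 0 and p - (4s+7)q ≥ 0. Let P be a partially ordered set on which G_s(p,q) acts (on the right) by order automorphisms, and let k ∈ G_s(p,q) satisfy M = k^q and L = k^{-p}. If x ∈ P satisfies x·l = x and the elements x and x·k are comparable (i.e. x < x·k, x·k < x, or x = x·k), then x·g = x for every g ∈ G_s(p,q). -/
/-- No element fixed by `l` is moved up by `k`. -/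
theorem no_move_up {G P : Type*} [Group G] [PartialOrder P]
    (act : P → G → P)
    (act_one : ∀ x : P, act x 1 = x)
    (act_mul : ∀ (x : P) (g h : G), act x (g * h) = act (act x g) h)
    (act_le : ∀ g : G, ∀ x y : P, x ≤ y ↔ act x g ≤ act y g)
    (k c l : G) (s q N : ℤ) (hq : 0 < q) (hN : 0 ≤ N) (hc : c = k ^ q)
    (hw : l * c * l ^ s * c * l ^ s * c * l = k ^ (-N))
    (x : P) (hxl : act x l = x) : ¬ x < act x k := by
  intro hx
  have act_lt : ∀ g : G, ∀ x y : P, x < y → act x g < act y g := by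
    intro g x y h
    rw [lt_iff_le_not_ge] at h ⊢
    rwa [← act_le g x y, ← act_le g y x]
  have hn : ∀ n : ℕ, x ≤ act x (k ^ n) := by
    intro n
    induction n with
    | zero => simp [act_one]
    | succ n ih =>
      rw [pow_succ, act_mul]
      exact hx.le.trans ((act_le k _ _).1 ih)
  have hxc : x < act x c := by
    obtain ⟨m, rfl⟩ := Int.eq_succ_of_zero_lt hq
    rw [hc, zpow_add_one, zpow_natCast, act_mul]
    exact lt_of_lt_of_le hx ((act_le k _ _).1 (hn m))
  have hinv : ∀ g : G, act x g = x → act x g⁻¹ = x := by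
    intro g h
    have := act_mul x g g⁻¹
    rw [mul_inv_cancel, act_one, h] at this
    exact this.symm
  have hpow : ∀ n : ℕ, act x (l ^ n) = x := by
    intro n
    induction n with
    | zero => simp [act_one]
    | succ n ih => rw [pow_succ, act_mul, ih, hxl]
  have hls : act x (l ^ s) = x := by
    obtain ⟨n, rfl | rfl⟩ := Int.eq_nat_or_neg s
    · rw [zpow_natCast, hpow]
    · rw [zpow_neg, zpow_natCast]; exact hinv _ (hpow n)
  have stepc : ∀ y, x < y → x < act y c := fun y h => hxc.trans (act_lt c _ _ h)
  have steps : ∀ y, x < y → x < act y (l ^ s) := fun y h => by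
    have := act_lt (l ^ s) _ _ h
    rwa [hls] at this
  have stepl : ∀ y, x < y → x < act y l := fun y h => by
    have := act_lt l _ _ h
    rwa [hxl] at this
  have h1 : x < act x (l * c * l ^ s * c * l ^ s * c * l) := by
    simp only [act_mul, hxl]
    exact stepl _ (stepc _ (steps _ (stepc _ (steps _ hxc))))
  obtain ⟨m, rfl⟩ := Int.eq_ofNat_of_zero_le hN
  rw [hw] at h1
  have h2 := (act_le (k ^ (-(m : ℤ))) _ _).1 (hn m)
  rw [← act_mul, zpow_neg, zpow_natCast, mul_inv_cancel, act_one] at h2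
  rw [zpow_neg, zpow_natCast] at h1
  exact absurd h2 h1.not_ge

/-- Lemma 3.3(2) of the paper, cf. Jun Lemma 15, RSS Lemma 3.5.
Suppose `q > 0`, `p - (4s+7)q ≥ 0`, and `G_s(p,q)` acts on the right on a
partially ordered set `P` by order automorphisms.  If `x·l = x` and `x`, `x·k`
are comparable, then `x` is fixed by every element of `G_s(p,q)`. -/
theorem fixed_point_of_l_fixed (s p q : ℤ) (hs : 3 ≤ s) (hpq : IsCoprime p q)
    (hq : 0 < q) (hslope : 0 ≤ p - (4 * s + 7) * q)
    {P : Type*} [PartialOrder P]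
    (act : P → Gspq s p q → P)
    (act_one : ∀ x : P, act x 1 = x)
    (act_mul : ∀ (x : P) (g h : Gspq s p q), act x (g * h) = act (act x g) h)
    (act_le : ∀ g : Gspq s p q, ∀ x y : P, x ≤ y ↔ act x g ≤ act y g)
    (k : Gspq s p q)
    (hM : PresentedGroup.mk _ Mw = k ^ q)
    (hL : PresentedGroup.mk _ (Lw s) = k ^ (-p))
    (x : P) (hxl : act x (PresentedGroup.mk _ lw) = x)
    (hcomp : x < act x k ∨ act x k < x ∨ x = act x k) :
    ∀ g : Gspq s p q, act x g = x := by
  have hc : PresentedGroup.mk ({pretzelRel s, Mw ^ p * Lw s ^ q} : Set (FreeGroup (Fin 2))) cw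
      = k ^ q := hM
  generalize hcc : PresentedGroup.mk
    ({pretzelRel s, Mw ^ p * Lw s ^ q} : Set (FreeGroup (Fin 2))) cw = c at hc
  generalize hll : PresentedGroup.mk
    ({pretzelRel s, Mw ^ p * Lw s ^ q} : Set (FreeGroup (Fin 2))) lw = l at hxl
  have hw : l * c * l ^ s * c * l ^ s * c * l = k ^ (-(p - (4 * s + 7) * q)) := by
    have hLw : Lw s = cw ^ (-(2 * s - 2)) * lw * cw * lw ^ s * cw * lw ^ s * cw * lw
        * cw ^ (-(2 * s + 9)) := rfl
    have hL' := (congrArg (PresentedGroup.mk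
      ({pretzelRel s, Mw ^ p * Lw s ^ q} : Set (FreeGroup (Fin 2)))) hLw).symm.trans hL
    simp only [map_mul, map_zpow, hcc, hll] at hL'
    have h1 : l * c * l ^ s * c * l ^ s * c * l
        = c ^ (2 * s - 2) * (c ^ (-(2 * s - 2)) * l * c * l ^ s * c * l ^ s * c * l
          * c ^ (-(2 * s + 9))) * c ^ (2 * s + 9) := by
      rw [zpow_neg, zpow_neg]; group
    rw [h1, hL', hc, ← zpow_mul, ← zpow_mul, ← zpow_add, ← zpow_add]
    congr 1; ring
  rcases hcomp with h | h | h
  · exact absurd h (no_move_up act act_one act_mul act_le k c l s q _ hq hslope hc hw x hxl)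
  · exact absurd h (no_move_up (P := Pᵒᵈ) act act_one act_mul (fun g x y => act_le g y x)
      k c l s q _ hq hslope hc hw x hxl)
  · have hinv : ∀ g, act x g = x → act x g⁻¹ = x := by
      intro g h
      have := act_mul x g g⁻¹
      rw [mul_inv_cancel, act_one, h] at this
      exact this.symm
    let S : Subgroup (Gspq s p q) :=
      { carrier := {g | act x g = x}
        one_mem' := act_one x
        mul_mem' := fun {a b} ha hb => by
          change act x (a * b) = x
          rw [act_mul, show act x a = x from ha]; exact hb
        inv_mem' := fun {a} ha => hinv a ha }
    have hk : k ∈ S := h.symm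
    have hcS : c ∈ S := hc ▸ S.zpow_mem hk q
    have hlS : l ∈ S := hxl
    intro g
    change g ∈ S
    obtain ⟨w, rfl⟩ := PresentedGroup.mk_surjective _ g
    induction w using FreeGroup.induction_on with
    | C1 => rw [map_one]; exact S.one_mem
    | of i =>
      fin_cases i
      · exact hcc ▸ hcS
      · exact hll ▸ hlS
    | inv_of i hi => rw [map_inv]; exact S.inv_mem hi
    | mul a b ha hb => rw [map_mul]; exact S.mul_mem ha hb
end

section
/- Let s ≥ 3 be an integer and let p, q be coprime integers with q > 0. Suppose G_s(p,q) acts (on the right) on the real line ℝ by order-preserving bijections, and let k ∈ G_s(p,q) satisfy M = k^q and L = k^{-p}. If x·k > x for every x ∈ ℝ, then x·l > x for every x ∈ ℝ. -/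
/-- Lemma 3.4 of the paper, cf. Jun Lemma 16.
Suppose `q > 0` and `G_s(p,q)` acts on the right on `ℝ` by order-preserving
bijections, and `k` satisfies `M = k^q`, `L = k^{-p}`.  If `x·k > x` for all
`x ∈ ℝ`, then `x·l > x` for all `x ∈ ℝ`. -/
theorem l_moves_up_of_k_moves_up (s p q : ℤ) (hs : 3 ≤ s) (hpq : IsCoprime p q)
    (hq : 0 < q)
    (act : ℝ → Gspq s p q → ℝ)
    (act_one : ∀ x : ℝ, act x 1 = x)
    (act_mul : ∀ (x : ℝ) (g h : Gspq s p q), act x (g * h) = act (act x g) h)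
    (act_le : ∀ g : Gspq s p q, ∀ x y : ℝ, x ≤ y ↔ act x g ≤ act y g)
    (k : Gspq s p q)
    (hM : PresentedGroup.mk _ Mw = k ^ q)
    (hL : PresentedGroup.mk _ (Lw s) = k ^ (-p))
    (hk : ∀ x : ℝ, x < act x k) :
    ∀ x : ℝ, x < act x (PresentedGroup.mk _ lw) := by
  have lt : ∀ (g : Gspq s p q) (x y : ℝ), x < y → act x g < act y g := by
    intro g x y h
    rw [← not_le] at h ⊢
    rwa [← act_le g]
  obtain ⟨c, hc⟩ : ∃ c : Gspq s p q, c = PresentedGroup.mk _ cw := ⟨_, rfl⟩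
  obtain ⟨l, hl⟩ : ∃ l : Gspq s p q, l = PresentedGroup.mk _ lw := ⟨_, rfl⟩
  have hcup : ∀ x : ℝ, x < act x c := by
    have hck : c = k ^ q := by rw [hc]; exact hM
    obtain ⟨n, rfl⟩ : ∃ n : ℕ, q = (n : ℤ) + 1 := ⟨(q - 1).toNat, by omega⟩
    rw [hck]
    have key : ∀ (n : ℕ) (x : ℝ), x < act x (k ^ (n + 1)) := by
      intro n
      induction n with
      | zero => intro x; simpa using hk x
      | succ m ih =>
        intro x
        rw [pow_succ, act_mul]
        exact (ih x).trans (hk _)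
    intro x
    have := key n x
    rwa [← zpow_natCast, Nat.cast_add, Nat.cast_one] at this
  have hrel : c * l * c * l⁻¹ * c⁻¹ * l ^ (-s) * c⁻¹ * l⁻¹ * c * l * c * l ^ (s - 1) = 1 := by
    have h : (PresentedGroup.mk ({pretzelRel s, Mw ^ p * Lw s ^ q} : Set (FreeGroup (Fin 2))))
        (pretzelRel s) = 1 := PresentedGroup.one_of_mem (by simp)
    have hword : PresentedGroup.mk ({pretzelRel s, Mw ^ p * Lw s ^ q} : Set (FreeGroup (Fin 2)))
        (cw * lw * cw * lw⁻¹ * cw⁻¹ * lw ^ (-s) * cw⁻¹ * lw⁻¹ * cw * lw * cw * lw ^ (s - 1)) = 1 := h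
    simpa only [map_mul, map_inv, map_zpow, ← hc, ← hl] using hword
  have hR : c * l * c * l ^ (s - 1) * c * l * c = l * c * l * l ^ (s - 1) * c * l := by
    have h1 : c * l * c * l⁻¹ * c⁻¹ * l ^ (-s) * c⁻¹ * l⁻¹ = (c * l * c * l ^ (s - 1))⁻¹ := by
      rw [eq_inv_iff_mul_eq_one, ← hrel]
      group
    have h2 : l * l ^ (s - 1) = l ^ s := by
      rw [← zpow_one_add]; congr 1; ring
    have h3 : c * l * c = (c * l * c * l ^ (s - 1))⁻¹ * (l * c * l ^ s * c * l) := by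
      rw [← h1]; group
    calc c * l * c * l ^ (s - 1) * c * l * c
        = (c * l * c * l ^ (s - 1)) * (c * l * c) := by group
      _ = l * c * l ^ s * c * l := by
        rw [← eq_inv_mul_iff_mul_eq]; exact h3
      _ = _ := by rw [← h2]; group
  rw [← hl]
  intro x
  by_contra hx
  rw [not_lt] at hx
  have hE := congrArg (act x) hR
  simp only [act_mul] at hE
  have e1 := lt l _ _ (lt c _ _ (lt (l ^ (s - 1)) _ _ (hcup (act (act x c) l))))
  have e2 := (act_le l _ _).1 ((act_le c _ _).1 ((act_le (l ^ (s - 1)) _ _).1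
    ((act_le l _ _).1 ((act_le c _ _).1 hx))))
  have e3 := hcup (act (act (act (act (act (act x c) l) c) (l ^ (s - 1))) c) l)
  linarith
end

section
/- Let s ≥ 3 be an integer and let p, q be coprime integers with q > 0 and p ≥ (4s+7)q. Then for every group homomorphism Φ from G_s(p,q) to the group of order-preserving bijections of ℝ, there exists a point x ∈ ℝ such that Φ(g)(x) = x for every g ∈ G_s(p,q). -/
namespace PretzelAux

lemma pow_le_of (f : ℝ ≃o ℝ) (x : ℝ) (h : x ≤ f x) (n : ℕ) : x ≤ (f ^ n) x := by
  induction n with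
  | zero => simp
  | succ k ih =>
    rw [pow_succ', RelIso.mul_apply]
    exact h.trans (f.monotone ih)

lemma pow_lt_of (f : ℝ ≃o ℝ) (x : ℝ) (h : x < f x) (n : ℕ) : x < (f ^ (n + 1)) x := by
  rw [pow_succ', RelIso.mul_apply]
  exact h.trans_le (f.monotone (pow_le_of f x h.le n))

lemma pow_eq_of (f : ℝ ≃o ℝ) (x : ℝ) (h : f x = x) (n : ℕ) : (f ^ n) x = x := by
  induction n with
  | zero => simp
  | succ k ih => rw [pow_succ', RelIso.mul_apply, ih, h]

lemma inv_lt_of (f : ℝ ≃o ℝ) (x : ℝ) (h : f x < x) : x < f⁻¹ x := by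
  rw [← f.lt_iff_lt, ← RelIso.mul_apply]; simpa using h

lemma inv_eq_of (f : ℝ ≃o ℝ) (x : ℝ) (h : f x = x) : f⁻¹ x = x := by
  apply f.injective
  rw [← RelIso.mul_apply]; simpa using h.symm

/-- `W = l c l^s c l^s c l`. -/
def W (c l : ℝ ≃o ℝ) (s : ℕ) : ℝ ≃o ℝ := l * c * l ^ s * c * l ^ s * c * l

lemma W_inv (c l : ℝ ≃o ℝ) (s : ℕ) : W c⁻¹ l⁻¹ s = (W c l s)⁻¹ := by
  simp only [W]; group

lemma W_ge (c l : ℝ ≃o ℝ) (s : ℕ) (x : ℝ) (hc : x ≤ c x) (hl : x ≤ l x) :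
    l x ≤ W c l s x := by
  have hs := pow_le_of l x hl s
  simp only [W, RelIso.mul_apply]
  have step : ∀ f : ℝ ≃o ℝ, x ≤ f x → ∀ y, x ≤ y → x ≤ f y :=
    fun f hf y hy => hf.trans (f.monotone hy)
  exact l.monotone (step c hc _ (step _ hs _ (step c hc _ (step _ hs _ (step c hc _ hl)))))

lemma W_gt (c l : ℝ ≃o ℝ) (s : ℕ) (x : ℝ) (hc : x < c x) (hl : x ≤ l x) :
    x < W c l s x := by
  have hs := pow_le_of l x hl s
  simp only [W, RelIso.mul_apply]
  have step : ∀ f : ℝ ≃o ℝ, x ≤ f x → ∀ y, x ≤ y → x ≤ f y :=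
    fun f hf y hy => hf.trans (f.monotone hy)
  refine hl.trans_lt (l.strictMono (hc.trans_le (c.monotone ?_)))
  exact (step _ hs _ (step c hc.le _ (step _ hs _ (step c hc.le _ hl))))

/-- The meridian cannot act by a positive translation. -/
lemma not_pos (c l : ℝ ≃o ℝ) (t q n : ℕ)
    (hR : c * l * c * l ^ t * c * l * c = l * c * l ^ (t + 1) * c * l)
    (hW : (W c l (t + 1)) ^ (q + 1) * c ^ n = 1) (hc : ∀ x, x < c x) : False := by
  have hl : ∀ x, l x < x := by
    intro x
    by_contra! h
    have hw := pow_lt_of _ x (W_gt c l (t + 1) x (hc x) h) q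
    have h1 : ((W c l (t + 1)) ^ (q + 1) * c ^ n) x = x := by rw [hW]; rfl
    rw [RelIso.mul_apply] at h1
    have h2 := ((W c l (t + 1)) ^ (q + 1)).monotone (pow_le_of c x (hc x).le n)
    linarith
  have h1 := congrArg (fun f : ℝ ≃o ℝ => f 0) hR
  simp only [RelIso.mul_apply, pow_succ'] at h1
  have e1 : l (c (l ((l ^ t) (c (l 0))))) < l (c ((l ^ t) (c (l 0)))) :=
    l.strictMono (c.strictMono (hl _))
  have e2 : l (c ((l ^ t) (c (l 0)))) < l (c ((l ^ t) (c (l (c 0))))) :=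
    l.strictMono (c.strictMono ((l ^ t).strictMono (c.strictMono (l.strictMono (hc 0)))))
  have e3 := hc (l (c ((l ^ t) (c (l (c 0))))))
  linarith

lemma fix_l (c l : ℝ ≃o ℝ) (s q n : ℕ)
    (hW : (W c l s) ^ (q + 1) * c ^ n = 1) (x : ℝ) (hc : c x = x) : l x ≤ x := by
  by_contra! h
  have hw := pow_lt_of _ x (h.trans_le (W_ge c l s x hc.ge h.le)) q
  have h1 : ((W c l s) ^ (q + 1) * c ^ n) x = x := by rw [hW]; rfl
  rw [RelIso.mul_apply, pow_eq_of c x hc] at h1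
  linarith

lemma W_comm (c l : ℝ ≃o ℝ) (t : ℕ)
    (hR : c * l * c * l ^ t * c * l * c = l * c * l ^ (t + 1) * c * l) :
    Commute c (W c l (t + 1)) := by
  have e1 : W c l (t + 1) = (c * l * c * l ^ t * c * l * c) * (l ^ t * c * l) := by
    rw [hR]; simp only [W, pow_succ']; group
  have e2 : W c l (t + 1) = (l * c * l ^ t) * (c * l * c * l ^ t * c * l * c) := by
    rw [hR]
    simp only [W]
    rw [show l ^ (t + 1) = l ^ t * l from pow_succ l t]; group
  show c * W c l (t + 1) = W c l (t + 1) * c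
  conv_lhs => rw [e2]
  rw [e1]; group

lemma main (c l : ℝ ≃o ℝ) (t q n : ℕ)
    (hR : c * l * c * l ^ t * c * l * c = l * c * l ^ (t + 1) * c * l)
    (hW : (W c l (t + 1)) ^ (q + 1) * c ^ n = 1) : ∃ x, c x = x ∧ l x = x := by
  have hcomm := W_comm c l t hR
  have hR' : c⁻¹ * l⁻¹ * c⁻¹ * l⁻¹ ^ t * c⁻¹ * l⁻¹ * c⁻¹ =
      l⁻¹ * c⁻¹ * l⁻¹ ^ (t + 1) * c⁻¹ * l⁻¹ := by
    have := congrArg (·⁻¹) hR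
    simpa only [mul_inv_rev, inv_pow, mul_assoc] using this
  have hW' : (W c⁻¹ l⁻¹ (t + 1)) ^ (q + 1) * c⁻¹ ^ n = 1 := by
    rw [W_inv, inv_pow, inv_pow, ← mul_inv_rev, (hcomm.pow_pow n (q + 1)).eq, hW, inv_one]
  have hfix : ∃ x, c x = x := by
    by_contra! hne
    have hcont : Continuous fun x => c x - x := c.continuous.sub continuous_id
    have hne' : ∀ x, c x - x ≠ 0 := fun x h => hne x (by linarith)
    by_cases h0 : 0 < c 0 - 0
    · refine not_pos c l t q n hR hW fun x => ?_
      by_contra! h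
      obtain ⟨y, hy⟩ := mem_range_of_exists_le_of_exists_ge hcont ⟨x, by linarith⟩ ⟨0, h0.le⟩
      exact hne' y hy
    · refine not_pos c⁻¹ l⁻¹ t q n hR' hW' fun x => inv_lt_of c x ?_
      by_contra! h
      obtain ⟨y, hy⟩ := mem_range_of_exists_le_of_exists_ge hcont ⟨0, not_lt.mp h0⟩
        ⟨x, by linarith⟩
      exact hne' y hy
  obtain ⟨x, hx⟩ := hfix
  refine ⟨x, hx, le_antisymm (fix_l c l _ q n hW x hx) ?_⟩
  by_contra! h
  have := fix_l c⁻¹ l⁻¹ _ q n hW' x (inv_eq_of c x hx)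
  have := inv_lt_of l x h
  linarith

end PretzelAux

/-- Proposition 3.5 of the paper, cf. Jun Proposition 17.
If `q > 0` and `p ≥ (4s+7)q`, then every homomorphism from `G_s(p,q)` to the
group of order-preserving bijections of `ℝ` has a global fixed point. -/
theorem exists_global_fixed_point (s p q : ℤ) (hs : 3 ≤ s) (hpq : IsCoprime p q)
    (hq : 0 < q) (hslope : (4 * s + 7) * q ≤ p)
    (Φ : Gspq s p q →* (ℝ ≃o ℝ)) :
    ∃ x : ℝ, ∀ g : Gspq s p q, Φ g x = x := by
  let Ψ : FreeGroup (Fin 2) →* (ℝ ≃o ℝ) := Φ.comp (PresentedGroup.mk _)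
  have h1 : Ψ (pretzelRel s) = 1 := by
    show Φ (PresentedGroup.mk _ _) = 1
    rw [PresentedGroup.one_of_mem (by simp), map_one]
  have h2 : Ψ (Mw ^ p * Lw s ^ q) = 1 := by
    show Φ (PresentedGroup.mk _ _) = 1
    rw [PresentedGroup.one_of_mem (by simp), map_one]
  obtain ⟨t, rfl⟩ : ∃ t : ℕ, s = t + 1 := ⟨(s - 1).toNat, by omega⟩
  obtain ⟨r, rfl⟩ : ∃ r : ℕ, q = r + 1 := ⟨(q - 1).toNat, by omega⟩
  obtain ⟨n, hn⟩ : ∃ n : ℕ, p = (4 * ((t : ℤ) + 1) + 7) * (r + 1) + n :=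
    ⟨(p - (4 * ((t : ℤ) + 1) + 7) * (r + 1)).toNat, by omega⟩
  obtain ⟨c, hc⟩ : ∃ c, c = Ψ cw := ⟨_, rfl⟩
  obtain ⟨l, hl⟩ : ∃ l, l = Ψ lw := ⟨_, rfl⟩
  simp only [pretzelRel, Mw, Lw, map_mul, map_zpow, map_inv, ← hc, ← hl] at h1 h2
  have hR : c * l * c * l ^ t * c * l * c = l * c * l ^ (t + 1) * c * l := by
    have e : c * l * c * l ^ t * c * l * c * (l * c * l ^ (t + 1) * c * l)⁻¹ =
        (c * l * c * l ^ t) * (c * l * c * l⁻¹ * c⁻¹ * l ^ (-((t : ℤ) + 1)) * c⁻¹ * l⁻¹ * c * l * c *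
          l ^ ((t : ℤ) + 1 - 1)) * (c * l * c * l ^ t)⁻¹ := by
      group
    rw [h1, mul_one, mul_inv_cancel] at e
    exact mul_inv_eq_one.mp e
  have hcomm := PretzelAux.W_comm c l t hR
  have hL : c ^ (-(2 * ((t : ℤ) + 1) - 2)) * l * c * l ^ ((t : ℤ) + 1) * c * l ^ ((t : ℤ) + 1) * c * l *
      c ^ (-(2 * ((t : ℤ) + 1) + 9)) =
      PretzelAux.W c l (t + 1) * c ^ (-(4 * ((t : ℤ) + 1) + 7)) := by
    have e : c ^ (-(2 * ((t : ℤ) + 1) - 2)) * l * c * l ^ ((t : ℤ) + 1) * c * l ^ ((t : ℤ) + 1) * c * l *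
      c ^ (-(2 * ((t : ℤ) + 1) + 9)) = c ^ (-(2 * ((t : ℤ) + 1) - 2)) * PretzelAux.W c l (t + 1) *
      c ^ (-(2 * ((t : ℤ) + 1) + 9)) := by
      simp only [PretzelAux.W, ← zpow_natCast, Nat.cast_add, Nat.cast_one, mul_assoc]
    rw [e, (hcomm.zpow_left _).eq, mul_assoc, ← zpow_add]
    congr 2; ring
  have hW : (PretzelAux.W c l (t + 1)) ^ (r + 1) * c ^ n = 1 := by
    rw [hL, (hcomm.symm.zpow_right _).mul_zpow, ← mul_assoc,
      ((hcomm.zpow_left p).zpow_right _).eq, mul_assoc, ← zpow_mul, ← zpow_add, hn] at h2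
    rw [← h2, ← zpow_natCast, ← zpow_natCast c n]
    congr 2
    ring
  obtain ⟨x, hcx, hlx⟩ := PretzelAux.main c l t r n hR hW
  refine ⟨x, fun g => ?_⟩
  obtain ⟨w, rfl⟩ := PresentedGroup.mk_surjective _ g
  show Ψ w x = x
  have hgen : ∀ i : Fin 2, Ψ (FreeGroup.of i) x = x := by
    intro i
    fin_cases i
    · rw [hc] at hcx; exact hcx
    · rw [hl] at hlx; exact hlx
  induction w using FreeGroup.induction_on with
  | C1 => simp
  | of i => exact hgen i
  | inv_of i h => rw [map_inv]; exact PretzelAux.inv_eq_of _ _ h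
  | mul a b ha hb => rw [map_mul, RelIso.mul_apply, hb, ha]
end

section
/- Let s ≥ 3 be an integer and let p, q be coprime integers with q > 0, p ≥ (4s+7)q, and p odd. Then the group G_s(p,q) is not left-orderable. -/
/-- The subgroup of elements whose left multiplication preserves membership in `D`. -/
def stabD {G : Type*} [Group G] (D : Set G) : Subgroup G where
  carrier := {g | ∀ x, g * x ∈ D ↔ x ∈ D}
  mul_mem' := by
    intro a b ha hb x
    rw [mul_assoc, ha, hb]
  one_mem' := by intro x; simp
  inv_mem' := by
    intro a ha x
    rw [← ha]; simp

theorem mem_stabD {G : Type*} [Group G] {D : Set G} {g : G} :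
    g ∈ stabD D ↔ ∀ x, g * x ∈ D ↔ x ∈ D := Iff.rfl

theorem pow_pres {G : Type*} [Group G] {D : Set G} {g : G}
    (h : ∀ x ∈ D, g * x ∈ D) (n : ℕ) : ∀ x ∈ D, g ^ n * x ∈ D := by
  induction n with
  | zero => intro x hx; simpa using hx
  | succ n ih =>
    intro x hx
    rw [pow_succ, mul_assoc]
    exact ih _ (h x hx)

/-- A down-set preserved by `c` and by `l c l^s c l^s c l` is preserved by `l`. -/
theorem l_mem_stabD {G : Type*} [Group G] [LinearOrder G]
    (hl : ∀ f g h : G, g < h → f * g < f * h) (c l : G) (s : ℕ) (D : Set G)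
    (hD : ∀ x y, x ≤ y → y ∈ D → x ∈ D) (hc : c ∈ stabD D)
    (hZ : l * c * l ^ s * c * l ^ s * c * l ∈ stabD D) : l ∈ stabD D := by
  have hc1 : ∀ x ∈ D, c * x ∈ D := fun x hx => (hc x).2 hx
  have hc2 : ∀ x ∈ D, c⁻¹ * x ∈ D := fun x hx => ((stabD D).inv_mem hc x).2 hx
  have hZ2 : ∀ x ∈ D, (l * c * l ^ s * c * l ^ s * c * l)⁻¹ * x ∈ D :=
    fun x hx => ((stabD D).inv_mem hZ x).2 hx
  by_cases h : ∀ x ∈ D, l * x ∈ D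
  · intro x
    refine ⟨fun hx => ?_, h x⟩
    have h1 := hc1 _ (pow_pres h s _ (hc1 _ (pow_pres h s _ (hc1 _ (h _ (hZ2 _ hx))))))
    have : c * (l ^ s * (c * (l ^ s * (c * (l *
        ((l * c * l ^ s * c * l ^ s * c * l)⁻¹ * (l * x))))))) = x := by group
    rwa [this] at h1
  · push Not at h
    obtain ⟨x, hx, hlx⟩ := h
    have h2 : ∀ y ∈ D, l⁻¹ * y ∈ D := by
      intro y hy
      have : y < l * x := by
        by_contra hcon
        exact hlx (hD _ _ (not_lt.1 hcon) hy)
      have := hl l⁻¹ _ _ this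
      rw [inv_mul_cancel_left] at this
      exact hD _ _ this.le hx
    have h1 := hc2 _ (pow_pres h2 s _ (hc2 _ (pow_pres h2 s _ (hc2 _ (h2 _ ((hZ x).2 hx))))))
    have : c⁻¹ * (l⁻¹ ^ s * (c⁻¹ * (l⁻¹ ^ s * (c⁻¹ * (l⁻¹ *
        ((l * c * l ^ s * c * l ^ s * c * l) * x)))))) = l * x := by
      simp only [inv_pow, mul_assoc, inv_mul_cancel_left]
    rw [this] at h1
    exact absurd h1 hlx

theorem core {G : Type*} [Group G] [LinearOrder G]
    (hl : ∀ f g h : G, g < h → f * g < f * h) (c l k : G) (n q m : ℕ) (hq : 0 < q)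
    (hgen : ∀ S : Subgroup G, c ∈ S → l ∈ S → S = ⊤)
    (hrel : c * l * c * l ^ n * c * l * c = l * c * l ^ (n + 1) * c * l)
    (hc : c = k ^ q)
    (hZ : l * c * l ^ (n + 1) * c * l ^ (n + 1) * c * l = (k ^ m)⁻¹) (hk : 1 < k) : False := by
  have hle : ∀ f g h : G, g ≤ h → f * g ≤ f * h := by
    intro f g h hgh
    rcases hgh.lt_or_eq with h1 | h1
    · exact (hl f g h h1).le
    · rw [h1]
  -- orbits of powers of k are cofinal
  have cof : ∀ g h : G, ∃ j : ℤ, h ≤ k ^ j * g := by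
    intro g
    let D : Set G := {h | ∃ j : ℤ, h ≤ k ^ j * g}
    have hkD : k ∈ stabD D := by
      intro x
      constructor
      · rintro ⟨j, hj⟩
        refine ⟨j - 1, ?_⟩
        have := hle k⁻¹ _ _ hj
        rw [inv_mul_cancel_left] at this
        convert this using 1
        group
      · rintro ⟨j, hj⟩
        refine ⟨j + 1, ?_⟩
        convert hle k _ _ hj using 1
        group
    have hcD : c ∈ stabD D := hc ▸ (stabD D).pow_mem hkD q
    have hlD : l ∈ stabD D := by
      refine l_mem_stabD hl c l (n + 1) D ?_ hcD ?_
      · rintro x y hxy ⟨j, hj⟩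
        exact ⟨j, hxy.trans hj⟩
      · rw [hZ]
        exact (stabD D).inv_mem ((stabD D).pow_mem hkD m)
    have htop := hgen _ hcD hlD
    intro h
    have h1 : h * g⁻¹ ∈ stabD D := by rw [htop]; trivial
    have h2 : g ∈ D := ⟨0, by simp⟩
    have h3 := (h1 g).2 h2
    rwa [inv_mul_cancel_right] at h3
  -- k moves everything up
  have kup : ∀ g : G, g < k * g := by
    intro g
    by_contra hcon
    have hkg : k * g ≤ g := not_lt.1 hcon
    have p1 : ∀ j : ℕ, k ^ j * g ≤ g := by
      intro j
      induction j with
      | zero => simp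
      | succ j ih => rw [pow_succ, mul_assoc]; exact (hle _ _ _ hkg).trans ih
    have p2 : ∀ j : ℕ, (k ^ j)⁻¹ ≤ 1 := by
      intro j
      induction j with
      | zero => simp
      | succ j ih =>
        have := hle (k ^ (j + 1))⁻¹ _ _ hk.le
        refine le_trans ?_ ih
        rw [mul_one] at this
        convert this using 1
        rw [pow_succ]; group
    rcases lt_trichotomy 1 g with h | h | h
    · obtain ⟨j, hj⟩ := cof 1 g
      rw [mul_one] at hj
      rcases j with j | j
      · have := hl (k ^ j) _ _ h
        rw [mul_one] at this
        have h3 := this.trans_le (p1 j)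
        simp only [Int.ofNat_eq_natCast, zpow_natCast] at hj
        exact absurd hj (not_le.2 h3)
      · rw [zpow_negSucc] at hj
        exact absurd (hj.trans (p2 _)) (not_le.2 h)
    · subst h
      rw [mul_one] at hkg
      exact absurd hk (not_lt.2 hkg)
    · obtain ⟨j, hj⟩ := cof g 1
      rcases j with j | j
      · simp only [Int.ofNat_eq_natCast, zpow_natCast] at hj
        exact absurd (hj.trans (p1 j)) (not_le.2 h)
      · rw [zpow_negSucc] at hj
        have := hl (k ^ (j + 1))⁻¹ _ _ h
        rw [mul_one] at this
        exact absurd (hj.trans_lt (this.trans_le (p2 _))) (lt_irrefl _)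
  have kpow : ∀ (j : ℕ) (x : G), x ≤ k ^ j * x := by
    intro j
    induction j with
    | zero => simp
    | succ j ih =>
      intro x
      rw [pow_succ, mul_assoc]
      exact (kup x).le.trans (ih _)
  have cup : ∀ x : G, x < c * x := by
    intro x
    obtain ⟨r, rfl⟩ : ∃ r, q = r + 1 := ⟨q - 1, by omega⟩
    rw [hc, pow_succ, mul_assoc]
    exact (kup x).trans_le (kpow r _)
  have zdn : ∀ x : G, l * c * l ^ (n + 1) * c * l ^ (n + 1) * c * l * x ≤ x := by
    intro x
    rw [hZ]
    have := hle (k ^ m)⁻¹ _ _ (kpow m x)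
    rwa [inv_mul_cancel_left] at this
  have ldn : ∀ x : G, l * x < x := by
    intro x
    by_contra hcon
    have hx : x ≤ l * x := not_lt.1 hcon
    have e : ∀ y ∈ Set.Ioi x, l * y ∈ Set.Ioi x := fun y hy => lt_of_le_of_lt hx (hl l _ _ hy)
    have e' : ∀ y ∈ Set.Ioi x, c * y ∈ Set.Ioi x := fun y hy => lt_trans hy (cup y)
    have h0 : c * (l * x) ∈ Set.Ioi x := lt_of_le_of_lt hx (cup _)
    have h1 := e _ (e' _ (pow_pres e (n + 1) _ (e' _ (pow_pres e (n + 1) _ h0))))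
    have h2 := zdn x
    simp only [mul_assoc] at h2
    exact absurd h1 (not_lt.2 h2)
  -- contradiction with the relator
  have a1 : l * c * l ^ n * c * l < l * c * l ^ n * c * l * c := by
    have := hl (l * c * l ^ n * c * l) _ _ (cup 1)
    simpa only [mul_one] using this
  have a2 := a1.trans (cup _)
  have a3 : l * c * l ^ (n + 1) * c * l < l * c * l ^ n * c * l := by
    have := hl (l * c * l ^ n) _ _ (ldn (c * l))
    simpa only [pow_succ, mul_assoc] using this
  have a4 := a3.trans a2
  rw [← hrel] at a4
  simp only [mul_assoc] at a4
  exact lt_irrefl _ a4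

theorem core2 {G : Type*} [Group G] [inst : LinearOrder G]
    (hl : ∀ f g h : G, g < h → f * g < f * h) (c l k : G) (n q m : ℕ) (hq : 0 < q)
    (hgen : ∀ S : Subgroup G, c ∈ S → l ∈ S → S = ⊤)
    (hrel : c * l * c * l ^ n * c * l * c = l * c * l ^ (n + 1) * c * l)
    (hc : c = k ^ q)
    (hZ : l * c * l ^ (n + 1) * c * l ^ (n + 1) * c * l = (k ^ m)⁻¹) : k = 1 := by
  rcases lt_trichotomy 1 k with h | h | h
  · exact (core hl c l k n q m hq hgen hrel hc hZ h).elim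
  · exact h.symm
  · let I2 : LinearOrder G := (inferInstance : LinearOrder Gᵒᵈ)
    exact (@core G _ I2 (fun f g h hgh => hl f h g hgh) c l k n q m hq hgen hrel hc hZ h).elim

/-- Purely group-theoretic reduction. -/
theorem reduction {G : Type*} [Group G] [inst : LinearOrder G]
    (hl : ∀ f g h : G, g < h → f * g < f * h) (c l : G) (s p q : ℤ)
    (hs : 3 ≤ s) (hpq : IsCoprime p q) (hq : 0 < q) (hslope : (4 * s + 7) * q ≤ p)
    (hgen : ∀ S : Subgroup G, c ∈ S → l ∈ S → S = ⊤)
    (hrel : c * l * c * l⁻¹ * c⁻¹ * l ^ (-s) * c⁻¹ * l⁻¹ * c * l * c * l ^ (s - 1) = 1)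
    (hML : c ^ p * (c ^ (-(2 * s - 2)) * l * c * l ^ s * c * l ^ s * c * l *
      c ^ (-(2 * s + 9))) ^ q = 1) : c = 1 := by
  obtain ⟨n, rfl⟩ : ∃ n : ℕ, s = (n : ℤ) + 1 := ⟨(s - 1).toNat, by omega⟩
  have e1 : l ^ ((n : ℤ) + 1) = l ^ (n + 1) := by exact_mod_cast zpow_natCast l (n + 1)
  have e2 : l ^ ((n : ℤ) + 1 - 1) = l ^ n := by rw [add_sub_cancel_right, zpow_natCast]
  rw [zpow_neg, e1, e2] at hrel
  rw [e1] at hML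
  have hrel' : c * l * c * l ^ n * c * l * c = l * c * l ^ (n + 1) * c * l := by
    have h1 : (c * l * c) * (l * c * l ^ (n + 1) * c * l)⁻¹ * (c * l * c * l ^ n) = 1 := by
      rw [← hrel]; simp only [mul_inv_rev, mul_assoc]
    have h2 : (c * l * c * l ^ n) * ((c * l * c) * (l * c * l ^ (n + 1) * c * l)⁻¹) = 1 :=
      mul_eq_one_comm.1 h1
    rw [← mul_assoc] at h2
    have h3 := mul_inv_eq_one.1 h2
    rw [← h3]; simp only [mul_assoc]
  set Z := l * c * l ^ (n + 1) * c * l ^ (n + 1) * c * l with hZdef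
  have z1 : Z = c * l * c * l ^ n * c * l * c * l ^ n * c * l := by
    rw [hrel', hZdef]; simp only [pow_succ', mul_assoc]
  have z2 : Z = l * c * l ^ n * (c * l * c * l ^ n * c * l * c) := by
    rw [hrel', hZdef]; simp only [pow_succ, mul_assoc]
  have hcomm : Commute c Z := by
    have : c * Z = Z * c := by
      conv_rhs => rw [z1]
      rw [z2]; simp only [mul_assoc]
    exact this
  set L := c ^ (-(2 * ((n : ℤ) + 1) - 2)) * Z * c ^ (-(2 * ((n : ℤ) + 1) + 9)) with hLdef
  have hML' : c ^ p * L ^ q = 1 := by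
    rw [← hML, hLdef, hZdef]; simp only [mul_assoc]
  have hcL : Commute c L :=
    (((Commute.refl c).zpow_right _).mul_right hcomm).mul_right ((Commute.refl c).zpow_right _)
  obtain ⟨a, b, hab⟩ := hpq
  -- a * p + b * q = 1
  have hcLp : ∀ i j : ℤ, Commute (c ^ i) (L ^ j) := fun i j => (hcL.zpow_zpow i j)
  set k := c ^ b * L ^ (-a) with hk
  have hLq : L ^ q = c ^ (-p) := by
    rw [zpow_neg]; exact (inv_eq_of_mul_eq_one_right hML').symm
  have hcp : c ^ p = L ^ (-q) := by
    rw [zpow_neg]; exact eq_inv_of_mul_eq_one_left hML'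
  have hkq : k ^ q = c := by
    rw [hk, (hcLp _ _).mul_zpow, ← zpow_mul, ← zpow_mul, mul_comm (-a) q, zpow_mul L, hLq,
      ← zpow_mul, ← zpow_add]
    have : b * q + -p * -a = 1 := by linarith
    rw [this, zpow_one]
  have hkp : k ^ (-p) = L := by
    rw [hk, (hcLp _ _).mul_zpow, ← zpow_mul, ← zpow_mul, show b * -p = p * (-b) by ring,
      zpow_mul c, hcp, ← zpow_mul, ← zpow_add]
    have : -q * -b + -a * -p = 1 := by linarith
    rw [this, zpow_one]
  have hZ : Z = k ^ (-(p - (4 * ((n : ℤ) + 1) + 7) * q)) := by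
    have : Z = c ^ (2 * ((n : ℤ) + 1) - 2) * L * c ^ (2 * ((n : ℤ) + 1) + 9) := by
      rw [hLdef]; group
    rw [this, ← hkp, ← hkq, ← zpow_mul, ← zpow_mul, ← zpow_add, ← zpow_add]
    congr 1; ring
  obtain ⟨q', rfl⟩ : ∃ q' : ℕ, q = q' := ⟨q.toNat, by omega⟩
  obtain ⟨m, hm⟩ : ∃ m : ℕ, p - (4 * ((n : ℤ) + 1) + 7) * (q' : ℤ) = m :=
    ⟨(p - (4 * ((n : ℤ) + 1) + 7) * (q' : ℤ)).toNat, by omega⟩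
  rw [hm, zpow_neg, zpow_natCast] at hZ
  rw [zpow_natCast] at hkq
  have hk1 := core2 hl c l k n q' m (by exact_mod_cast hq) hgen hrel' hkq.symm hZ
  rw [← hkq, hk1, one_pow]

/-- Corollary 4.2 of the paper.  If `q > 0`, `p ≥ (4s+7)q` and
`p` is odd, then `G_s(p,q)` is not left-orderable: there is no linear order on
`G_s(p,q)` invariant under left multiplication. -/
theorem Gspq_not_leftOrderable (s p q : ℤ) (hs : 3 ≤ s) (hpq : IsCoprime p q)
    (hq : 0 < q) (hslope : (4 * s + 7) * q ≤ p) (hodd : Odd p) :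
    ¬ ∃ inst : LinearOrder (Gspq s p q),
        ∀ f g h : Gspq s p q, inst.lt g h → inst.lt (f * g) (f * h) := by
  rintro ⟨inst, hl⟩
  let rels : Set (FreeGroup (Fin 2)) := {pretzelRel s, Mw ^ p * Lw s ^ q}
  let c : Gspq s p q := PresentedGroup.of 0
  let l : Gspq s p q := PresentedGroup.of 1
  have hgen : ∀ S : Subgroup (Gspq s p q), c ∈ S → l ∈ S → S = ⊤ := by
    intro S hc hl
    rw [eq_top_iff, ← PresentedGroup.closure_range_of, Subgroup.closure_le]
    rintro _ ⟨i, rfl⟩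
    fin_cases i
    · exact hc
    · exact hl
  have r1 : PresentedGroup.mk rels (pretzelRel s) = 1 :=
    PresentedGroup.one_of_mem (Or.inl rfl)
  have r2 : PresentedGroup.mk rels (Mw ^ p * Lw s ^ q) = 1 :=
    PresentedGroup.one_of_mem (Or.inr rfl)
  have hc0 : PresentedGroup.mk rels cw = c := rfl
  have hl0 : PresentedGroup.mk rels lw = l := rfl
  simp only [pretzelRel, Mw, Lw, map_mul, map_zpow, map_inv, hc0, hl0] at r1 r2
  have hc1 : c = 1 := reduction hl c l s p q hs hpq hq hslope hgen r1 r2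
  -- but the abelianization is `ZMod p`
  let f : Fin 2 → Multiplicative (ZMod p.toNat) :=
    ![Multiplicative.ofAdd 1, Multiplicative.ofAdd 2]
  have hp : 19 ≤ p := by nlinarith
  have hf : ∀ r ∈ rels, FreeGroup.lift f r = 1 := by
    have e1 : FreeGroup.lift f cw = Multiplicative.ofAdd 1 := by simp [cw, f]
    have e2 : FreeGroup.lift f lw = Multiplicative.ofAdd 2 := by simp [lw, f]
    have hp0 : ((p : ℤ) : ZMod p.toNat) = 0 := by
      rw [ZMod.intCast_zmod_eq_zero_iff_dvd]
      exact ⟨1, by omega⟩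
    rintro r (rfl | rfl)
    · simp only [pretzelRel, map_mul, map_zpow, map_inv, e1, e2]
      apply Multiplicative.toAdd.injective
      simp only [toAdd_mul, toAdd_zpow, toAdd_inv, toAdd_ofAdd, toAdd_one, zsmul_eq_mul]
      push_cast
      ring
    · simp only [Mw, Lw, map_mul, map_zpow, map_inv, e1, e2]
      apply Multiplicative.toAdd.injective
      simp only [toAdd_mul, toAdd_zpow, toAdd_inv, toAdd_ofAdd, toAdd_one, zsmul_eq_mul]
      rw [hp0]
      push_cast
      ring
  have h1 : PresentedGroup.toGroup hf c = f 0 := PresentedGroup.toGroup.of hf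
  rw [hc1, map_one] at h1
  have h2 : (1 : ZMod p.toNat) = 0 := (congrArg Multiplicative.toAdd h1).symm
  haveI : Fact (1 < p.toNat) := ⟨by omega⟩
  exact one_ne_zero h2
end

section
/- Let s ≥ 3 be an integer. In the presented group G_s, the identity (l⁻¹ c l c l⁻¹ c⁻¹)^{s-1} = l⁻ˢ c⁻¹ l⁻¹ c^{-(s-1)} l c l^s holds, where c and l denote the images of the generators in G_s. -/
/-- The image of the generator `c` in `G_s`. -/
def cG (s : ℤ) : Gs s := PresentedGroup.mk _ cw

/-- The image of the generator `l` in `G_s`. -/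
def lG (s : ℤ) : Gs s := PresentedGroup.mk _ lw


/-- In `G_s` the identity
`(l⁻¹ c l c l⁻¹ c⁻¹)^(s-1) = l⁻ˢ c⁻¹ l⁻¹ c^{-(s-1)} l c l^s` holds. -/
theorem Gs_identity_ten (s : ℤ) (hs : 3 ≤ s) :
    ((lG s)⁻¹ * cG s * lG s * cG s * (lG s)⁻¹ * (cG s)⁻¹) ^ (s - 1) =
      lG s ^ (-s) * (cG s)⁻¹ * (lG s)⁻¹ * cG s ^ (-(s - 1)) * lG s * cG s * lG s ^ s := by
  have hrel : cG s * lG s * cG s * (lG s)⁻¹ * (cG s)⁻¹ * lG s ^ (-s) * (cG s)⁻¹ * (lG s)⁻¹ *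
      cG s * lG s * cG s * lG s ^ (s - 1) = 1 := by
    have h : PresentedGroup.mk ({pretzelRel s} : Set (FreeGroup (Fin 2))) (pretzelRel s) = 1 :=
      PresentedGroup.one_of_mem rfl
    rw [← h]
    simp only [cG, lG, ← map_mul, ← map_inv, ← map_zpow]
    rfl
  generalize cG s = c at *
  generalize lG s = l at *
  have hw : l⁻¹ * c * l * c * l⁻¹ * c⁻¹ = (l * c * l ^ s)⁻¹ * c⁻¹ * ((l * c * l ^ s)⁻¹)⁻¹ := by
    have h2 : c * l * c * l⁻¹ * c⁻¹ =
        (l ^ (-s) * c⁻¹ * l⁻¹ * c * l * c * l ^ (s - 1))⁻¹ := by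
      rw [eq_inv_iff_mul_eq_one, ← hrel]
      simp only [mul_assoc]
    have h3 : l⁻¹ * c * l * c * l⁻¹ * c⁻¹ = l⁻¹ * (c * l * c * l⁻¹ * c⁻¹) := by
      simp only [mul_assoc]
    rw [h3, h2]
    group
  rw [hw, conj_zpow]
  group
end

section
/- Let s ≥ 3 be an integer. In the presented group G_s, the following equality of words in the generators c, l holds: c^{-(s-1)} · l c l^s · (l⁻¹ c l c l⁻¹ c⁻¹)^{s-1} · l⁻¹ c l c l^{s-1} c l · c^{-(2s+8)} = c^{-(2s-2)} · l c l^s c l^s c l · c^{-(2s+9)}. (That is, the longitude word L₁₂ produced by the Tietze-transformation procedure equals the simplified longitude word L.) -/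
/-- The simplification, in any group where the pretzel relation holds. -/
theorem longitude_aux {G : Type*} [Group G] (c l : G) (s : ℤ)
    (h : c * l * c * l⁻¹ * c⁻¹ * l ^ (-s) * c⁻¹ * l⁻¹ * c * l * c * l ^ (s - 1) = 1) :
    c ^ (-(s - 1)) * l * c * l ^ s * (l⁻¹ * c * l * c * l⁻¹ * c⁻¹) ^ (s - 1) *
        l⁻¹ * c * l * c * l ^ (s - 1) * c * l * c ^ (-(2 * s + 8)) =
      c ^ (-(2 * s - 2)) * l * c * l ^ s * c * l ^ s * c * l * c ^ (-(2 * s + 9)) := by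
  obtain ⟨p, hp⟩ : ∃ p, p = l ^ (s - 1) := ⟨_, rfl⟩
  have hls : l ^ s = l * p := by rw [hp, ← zpow_one_add]; congr 1; ring
  have hls' : l ^ s = p * l := by rw [hp, ← zpow_add_one]; congr 1; ring
  have hcm : l * p = p * l := hls.symm.trans hls'
  rw [zpow_neg, hls', ← hp] at h
  -- the relation in the form `c l c l^(s-1) = l c l^s c l (c l c)⁻¹`
  have h1 : c * l * c * p = l * c * (p * l) * c * l * c⁻¹ * l⁻¹ * c⁻¹ := by
    have := eq_inv_of_mul_eq_one_right
      (a := c * l * c * l⁻¹ * c⁻¹ * (p * l)⁻¹ * c⁻¹ * l⁻¹) (b := c * l * c * p)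
      (by simpa only [mul_assoc] using h)
    rw [this]; group
  -- the conjugation form
  have h2 : l⁻¹ * c * l * c * l⁻¹ * c⁻¹
      = (l * c * (p * l))⁻¹ * c⁻¹ * (l * c * (p * l))⁻¹⁻¹ := by
    have h3 : c * l * c = l * c * (p * l) * c * l * c⁻¹ * l⁻¹ * c⁻¹ * p⁻¹ :=
      eq_mul_inv_of_mul_eq h1
    have h4 : (l * c * (p * l)) * (l⁻¹ * (c * l * c) * l⁻¹ * c⁻¹)
        = c⁻¹ * (l * c * (p * l)) := by
      have h5 : l * c * p * (c * l * c) = c⁻¹ * (c * l * c * p) * (c * l * c) := by group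
      rw [h1] at h5
      have h6 : (l * c * (p * l)) * (l⁻¹ * (c * l * c) * l⁻¹ * c⁻¹)
        = (l * c * p * (c * l * c)) * l⁻¹ * c⁻¹ := by group
      rw [h6, h5]; group
    rw [inv_inv, mul_assoc _ c⁻¹, ← h4]; group
  rw [h2, conj_zpow, hls', ← hp]
  have h7 : c ^ (-(2 * s - 2)) = c ^ (-(s - 1)) * c⁻¹ ^ (s - 1) := by
    rw [inv_zpow', ← zpow_add]; congr 1; ring
  have h8 : c ^ (-(2 * s + 8)) = c * c ^ (-(2 * s + 9)) := by
    rw [← zpow_one_add]; congr 1; ring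
  rw [h7, h8]
  generalize c⁻¹ ^ (s - 1) = a
  generalize c ^ (-(s - 1)) = b
  generalize c ^ (-(2 * s + 9)) = d
  have h9 : (c * l * c * p) * (c * l * c) = l * c * (p * l) * c * l := by rw [h1]; group
  have h10 : b * l * c * (p * l) * ((l * c * (p * l))⁻¹ * a * (l * c * (p * l))⁻¹⁻¹) *
      l⁻¹ * c * l * c * p * c * l * (c * d)
      = b * a * (l * c * p) * ((c * l * c * p) * (c * l * c)) * d := by group
  rw [h10, h9]
  simp only [mul_assoc]

/-- In `G_s`, the longitude word `L₁₂` produced by the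
Tietze-transformation procedure equals the simplified longitude word `L`:
`c^{-(s-1)} l c l^s (l⁻¹ c l c l⁻¹ c⁻¹)^{s-1} l⁻¹ c l c l^{s-1} c l c^{-(2s+8)}
  = c^{-(2s-2)} l c l^s c l^s c l c^{-(2s+9)}`. -/
theorem Gs_longitude_simplification (s : ℤ) (hs : 3 ≤ s) :
    cG s ^ (-(s - 1)) * lG s * cG s * lG s ^ s *
        ((lG s)⁻¹ * cG s * lG s * cG s * (lG s)⁻¹ * (cG s)⁻¹) ^ (s - 1) *
        (lG s)⁻¹ * cG s * lG s * cG s * lG s ^ (s - 1) * cG s * lG s *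
        cG s ^ (-(2 * s + 8)) =
      cG s ^ (-(2 * s - 2)) * lG s * cG s * lG s ^ s * cG s * lG s ^ s * cG s * lG s *
        cG s ^ (-(2 * s + 9)) := by
  apply longitude_aux
  have h : PresentedGroup.mk ({pretzelRel s} : Set (FreeGroup (Fin 2))) (pretzelRel s) = 1 :=
    PresentedGroup.one_of_mem (Set.mem_singleton _)
  have key : ∀ (H : Type) [Group H] (f : FreeGroup (Fin 2) →* H), f (pretzelRel s) =
      f cw * f lw * f cw * (f lw)⁻¹ * (f cw)⁻¹ * f lw ^ (-s) * (f cw)⁻¹ * (f lw)⁻¹ *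
        f cw * f lw * f cw * f lw ^ (s - 1) := by
    intro H _ f
    simp only [pretzelRel, map_mul, map_inv, map_zpow]
  exact (key _ (PresentedGroup.mk _)).symm.trans h
end

section
/- Let s ≥ 3 be an integer. The presented group with seven generators a, b, c, d, e, f, g and the seven relators c a = a d, a c = c b, d f = f e, f e = e c, e c = c g, b g = a f, and (g⁻¹ b⁻¹)^s g (b g)^s a⁻¹ = 1 is isomorphic to the presented group G_s with two generators c, l and the single relator c l c l⁻¹ c⁻¹ l⁻ˢ c⁻¹ l⁻¹ c l c l^{s-1}. -/
/-- The generator `a` of the seven-generator presentation `G_{3,2s}`. -/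
def A7 : FreeGroup (Fin 7) := FreeGroup.of 0
/-- The generator `b` of the seven-generator presentation `G_{3,2s}`. -/
def B7 : FreeGroup (Fin 7) := FreeGroup.of 1
/-- The generator `c` of the seven-generator presentation `G_{3,2s}`. -/
def C7 : FreeGroup (Fin 7) := FreeGroup.of 2
/-- The generator `d` of the seven-generator presentation `G_{3,2s}`. -/
def D7 : FreeGroup (Fin 7) := FreeGroup.of 3
/-- The generator `e` of the seven-generator presentation `G_{3,2s}`. -/
def E7 : FreeGroup (Fin 7) := FreeGroup.of 4
/-- The generator `f` of the seven-generator presentation `G_{3,2s}`. -/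
def F7 : FreeGroup (Fin 7) := FreeGroup.of 5
/-- The generator `g` of the seven-generator presentation `G_{3,2s}`. -/
def G7 : FreeGroup (Fin 7) := FreeGroup.of 6

/-- The seven relators `ca = ad`, `ac = cb`, `df = fe`, `fe = ec`, `ec = cg`,
`bg = af` and `(g⁻¹b⁻¹)^s g (bg)^s a⁻¹ = 1` of the presentation `G_{3,2s}`,
where a relator `u = v` stands for the word `u * v⁻¹`. -/
def rels7 (s : ℤ) : Set (FreeGroup (Fin 7)) :=
  { C7 * A7 * (A7 * D7)⁻¹, A7 * C7 * (C7 * B7)⁻¹, D7 * F7 * (F7 * E7)⁻¹,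
    F7 * E7 * (E7 * C7)⁻¹, E7 * C7 * (C7 * G7)⁻¹, B7 * G7 * (A7 * F7)⁻¹,
    (G7⁻¹ * B7⁻¹) ^ s * G7 * (B7 * G7) ^ s * A7⁻¹ }

/-- Values in a group `H` (with elements `c`, `l`) of the seven generators. -/
def genVal {H : Type*} [Group H] (c l : H) : Fin 7 → H :=
  ![c * l * c⁻¹ * l⁻¹ * c⁻¹ * l,
    c⁻¹ * (c * l * c⁻¹ * l⁻¹ * c⁻¹ * l) * c,
    c,
    (c * l * c⁻¹ * l⁻¹ * c⁻¹ * l)⁻¹ * c * (c * l * c⁻¹ * l⁻¹ * c⁻¹ * l),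
    l⁻¹ * c * l,
    (l⁻¹ * c * l) * c * (l⁻¹ * c * l)⁻¹,
    c⁻¹ * (l⁻¹ * c * l) * c]

theorem genVal_rels {H : Type*} [Group H] (c l : H) (s : ℤ)
    (h : c * l * c * l⁻¹ * c⁻¹ * l ^ (-s) * c⁻¹ * l⁻¹ * c * l * c * l ^ (s - 1) = 1) :
    ∀ r ∈ rels7 s, FreeGroup.lift (genVal c l) r = 1 := by
  have hbg : c⁻¹ * (c * l * c⁻¹ * l⁻¹ * c⁻¹ * l) * c * (c⁻¹ * (l⁻¹ * c * l) * c) = l := by group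
  have hbg' : (c⁻¹ * (l⁻¹ * c * l) * c)⁻¹ * (c⁻¹ * (c * l * c⁻¹ * l⁻¹ * c⁻¹ * l) * c)⁻¹ = l⁻¹ := by
    group
  intro r hr
  simp only [rels7, Set.mem_insert_iff, Set.mem_singleton_iff] at hr
  rcases hr with rfl | rfl | rfl | rfl | rfl | rfl | rfl <;>
    simp only [A7, B7, C7, D7, E7, F7, G7, map_mul, map_inv, map_zpow, FreeGroup.lift_apply_of]
  · simp [genVal]; group
  · simp [genVal]; group
  · simp [genVal]; group
  · simp [genVal]; group
  · simp [genVal]; group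
  · simp [genVal]; group
  · change ((c⁻¹ * (l⁻¹ * c * l) * c)⁻¹ * (c⁻¹ * (c * l * c⁻¹ * l⁻¹ * c⁻¹ * l) * c)⁻¹) ^ s *
      (c⁻¹ * (l⁻¹ * c * l) * c) *
      (c⁻¹ * (c * l * c⁻¹ * l⁻¹ * c⁻¹ * l) * c * (c⁻¹ * (l⁻¹ * c * l) * c)) ^ s *
      (c * l * c⁻¹ * l⁻¹ * c⁻¹ * l)⁻¹ = 1
    rw [hbg, hbg', inv_zpow]
    rw [zpow_neg, zpow_sub_one] at h
    generalize l ^ s = P at h ⊢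
    have h2 : P⁻¹ * (c⁻¹ * (l⁻¹ * c * l) * c) * P * (c * l * c⁻¹ * l⁻¹ * c⁻¹ * l)⁻¹ =
      (c * l * c * l⁻¹ * c⁻¹)⁻¹ *
      (c * l * c * l⁻¹ * c⁻¹ * P⁻¹ * c⁻¹ * l⁻¹ * c * l * c * (P * l⁻¹)) *
      (c * l * c * l⁻¹ * c⁻¹) := by group
    rw [h2, h]; group

theorem key_facts {H : Type*} [Group H] (a b c d e f g : H) (s : ℤ)
    (h1 : c * a = a * d) (h2 : a * c = c * b) (h4 : f * e = e * c)
    (h5 : e * c = c * g) (h6 : b * g = a * f)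
    (h7 : (g⁻¹ * b⁻¹) ^ s * g * (b * g) ^ s * a⁻¹ = 1) :
    genVal c (b * g) = ![a, b, c, d, e, f, g] ∧
    (c * (b * g) * c * (b * g)⁻¹ * c⁻¹ * (b * g) ^ (-s) * c⁻¹ * (b * g)⁻¹ * c * (b * g) * c *
      (b * g) ^ (s - 1) = 1) := by
  have hb : b = c⁻¹ * a * c := by rw [mul_assoc, h2]; group
  have hd : d = a⁻¹ * c * a := by rw [mul_assoc, h1]; group
  have hg : g = c⁻¹ * e * c := by rw [mul_assoc, h5]; group
  have hf : f = e * c * e⁻¹ := by rw [← h4]; group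
  have hl : a * e = c * (b * g) * c⁻¹ := by rw [hb, hg]; group
  have hle : b * g * e = c * (b * g) := by
    calc b * g * e = (a * e) * c := by rw [h6, hf]; group
      _ = c * (b * g) := by rw [hl]; group
  have hinv : g⁻¹ * b⁻¹ = (b * g)⁻¹ := by group
  rw [hinv] at h7
  generalize hL : b * g = l at *
  have he : e = l⁻¹ * c * l := by rw [mul_assoc, ← hle]; group
  have ha : a = c * l * c⁻¹ * l⁻¹ * c⁻¹ * l := by
    rw [eq_mul_inv_of_mul_eq hl, he]; group
  constructor
  · simp only [genVal]
    rw [← ha, ← he, ← hb, ← hd, ← hg, ← hf]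
  · rw [ha, hg, he, inv_zpow] at h7
    rw [zpow_neg, zpow_sub_one]
    generalize l ^ s = P at h7 ⊢
    have h2 : c * l * c * l⁻¹ * c⁻¹ * P⁻¹ * c⁻¹ * l⁻¹ * c * l * c * (P * l⁻¹) =
      (c * l * c * l⁻¹ * c⁻¹) *
      (P⁻¹ * (c⁻¹ * (l⁻¹ * c * l) * c) * P * (c * l * c⁻¹ * l⁻¹ * c⁻¹ * l)⁻¹) *
      (c * l * c * l⁻¹ * c⁻¹)⁻¹ := by group
    rw [h2, h7]; group

theorem pretzel_lift {H : Type*} [Group H] (c l : H) (s : ℤ) :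
    FreeGroup.lift ![c, l] (pretzelRel s) =
      c * l * c * l⁻¹ * c⁻¹ * l ^ (-s) * c⁻¹ * l⁻¹ * c * l * c * l ^ (s - 1) := by
  simp only [pretzelRel, cw, lw, map_mul, map_inv, map_zpow, FreeGroup.lift_apply_of]
  rfl

/-- The seven-generator presentation `G_{3,2s}` is isomorphic
to the two-generator one-relator presentation `G_s`. -/
theorem presentation7_iso_Gs (s : ℤ) (hs : 3 ≤ s) :
    Nonempty (PresentedGroup (rels7 s) ≃* Gs s) := by
  let x : Fin 7 → PresentedGroup (rels7 s) := PresentedGroup.of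
  let c : Gs s := PresentedGroup.of 0
  let l : Gs s := PresentedGroup.of 1
  have hrel : ∀ r ∈ rels7 s, FreeGroup.lift x r = 1 := by
    intro r hr
    have : FreeGroup.lift x = PresentedGroup.mk (rels7 s) := by
      ext i; simp [x, PresentedGroup.of]
    rw [this]; exact PresentedGroup.one_of_mem hr
  have hc : c * l * c * l⁻¹ * c⁻¹ * l ^ (-s) * c⁻¹ * l⁻¹ * c * l * c * l ^ (s - 1) = 1 := by
    rw [← pretzel_lift]
    have : FreeGroup.lift ![c, l] = PresentedGroup.mk {pretzelRel s} := by
      ext i; fin_cases i <;> simp [c, l, PresentedGroup.of]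
    rw [this]; exact PresentedGroup.one_of_mem rfl
  have hk := key_facts (x 0) (x 1) (x 2) (x 3) (x 4) (x 5) (x 6) s
    (by simpa only [C7, A7, D7, mul_inv_eq_one, map_mul, map_inv, FreeGroup.lift_apply_of] using
      hrel (C7 * A7 * (A7 * D7)⁻¹) (by simp only [rels7, Set.mem_insert_iff, true_or, or_true]))
    (by simpa only [C7, A7, B7, mul_inv_eq_one, map_mul, map_inv, FreeGroup.lift_apply_of] using
      hrel (A7 * C7 * (C7 * B7)⁻¹) (by simp only [rels7, Set.mem_insert_iff, true_or, or_true]))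
    (by simpa only [F7, E7, C7, mul_inv_eq_one, map_mul, map_inv, FreeGroup.lift_apply_of] using
      hrel (F7 * E7 * (E7 * C7)⁻¹) (by simp only [rels7, Set.mem_insert_iff, true_or, or_true]))
    (by simpa only [G7, E7, C7, mul_inv_eq_one, map_mul, map_inv, FreeGroup.lift_apply_of] using
      hrel (E7 * C7 * (C7 * G7)⁻¹) (by simp only [rels7, Set.mem_insert_iff, true_or, or_true]))
    (by simpa only [B7, G7, A7, F7, mul_inv_eq_one, map_mul, map_inv, FreeGroup.lift_apply_of] using
      hrel (B7 * G7 * (A7 * F7)⁻¹) (by simp only [rels7, Set.mem_insert_iff, true_or, or_true]))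
    (by simpa only [B7, G7, A7, map_mul, map_inv, map_zpow, FreeGroup.lift_apply_of] using
      hrel ((G7⁻¹ * B7⁻¹) ^ s * G7 * (B7 * G7) ^ s * A7⁻¹) (by simp only [rels7, Set.mem_insert_iff, Set.mem_singleton_iff, or_true]))
  obtain ⟨hx, hp⟩ := hk
  let φ : PresentedGroup (rels7 s) →* Gs s := PresentedGroup.toGroup (genVal_rels c l s hc)
  let ψ : Gs s →* PresentedGroup (rels7 s) :=
    PresentedGroup.toGroup (f := ![x 2, x 1 * x 6]) (by
      intro r hr
      rw [Set.mem_singleton_iff] at hr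
      rw [hr, pretzel_lift]; exact hp)
  have hφ : ∀ i, φ (x i) = genVal c l i := fun i => PresentedGroup.toGroup.of _
  have hψc : ψ c = x 2 := PresentedGroup.toGroup.of _
  have hψl : ψ l = x 1 * x 6 := PresentedGroup.toGroup.of _
  have hnat : ∀ i, ψ (genVal c l i) = genVal (ψ c) (ψ l) i := by
    intro i
    fin_cases i <;> simp [genVal]
  refine ⟨MonoidHom.toMulEquiv φ ψ ?_ ?_⟩
  · apply PresentedGroup.ext
    intro i
    change ψ (φ (x i)) = x i
    rw [hφ, hnat, hψc, hψl, hx]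
    fin_cases i <;> rfl
  · apply PresentedGroup.ext
    intro i
    fin_cases i
    · change φ (ψ c) = c
      rw [hψc, hφ]; rfl
    · change φ (ψ l) = l
      rw [hψl, map_mul, hφ, hφ]
      change c⁻¹ * (c * l * c⁻¹ * l⁻¹ * c⁻¹ * l) * c * (c⁻¹ * (l⁻¹ * c * l) * c) = l
      group
end

section
/- Let s ≥ 3 be an integer. The group defined by the Wirtinger presentation with generators a, b, c, d, e, f, f₁, f₂, …, f_{2s-1}, g and relators c a = a d, a c = c b, d f = f e, f e = e c, e c = c g, f₁ a = a f, f₂ f₁ = f₁ a, f_{j+1} f_j = f_j f_{j-1} for j = 2, …, 2s-2, g f_{2s-1} = f_{2s-1} f_{2s-2}, and b g = g f_{2s-1}, is isomorphic to the presented group G_s with two generators c, l and the single relator c l c l⁻¹ c⁻¹ l⁻ˢ c⁻¹ l⁻¹ c l c l^{s-1}. (This is the two-generator one-relator presentation of the knot group of the (-2,3,2s+1)-pretzel knot obtained by the sequence of Tietze transformations.) -/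
/-- The generator type of the Wirtinger presentation of the
`(-2,3,2s+1)`-pretzel knot group: the seven arcs `a, b, c, d, e, f, g`
together with the arcs `f₁, f₂, …, f_{2s-1}`. -/
abbrev WirtGen (s : ℕ) := Fin 7 ⊕ Fin (2 * s - 1)

/-- The Wirtinger generator `a`. -/
def wA (s : ℕ) : FreeGroup (WirtGen s) := FreeGroup.of (Sum.inl 0)
/-- The Wirtinger generator `b`. -/
def wB (s : ℕ) : FreeGroup (WirtGen s) := FreeGroup.of (Sum.inl 1)
/-- The Wirtinger generator `c`. -/
def wC (s : ℕ) : FreeGroup (WirtGen s) := FreeGroup.of (Sum.inl 2)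
/-- The Wirtinger generator `d`. -/
def wD (s : ℕ) : FreeGroup (WirtGen s) := FreeGroup.of (Sum.inl 3)
/-- The Wirtinger generator `e`. -/
def wE (s : ℕ) : FreeGroup (WirtGen s) := FreeGroup.of (Sum.inl 4)
/-- The Wirtinger generator `f`. -/
def wF (s : ℕ) : FreeGroup (WirtGen s) := FreeGroup.of (Sum.inl 5)
/-- The Wirtinger generator `g`. -/
def wG (s : ℕ) : FreeGroup (WirtGen s) := FreeGroup.of (Sum.inl 6)

/-- The Wirtinger generator `f_j` for `1 ≤ j ≤ 2s-1`. -/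
def wf (s : ℕ) (j : ℕ) (h : 1 ≤ j ∧ j ≤ 2 * s - 1) : FreeGroup (WirtGen s) :=
  FreeGroup.of (Sum.inr ⟨j - 1, by omega⟩)

/-- The relators of the Wirtinger presentation of the knot group of the
`(-2,3,2s+1)`-pretzel knot:
`ca = ad`, `ac = cb`, `df = fe`, `fe = ec`, `ec = cg`, `f₁ a = a f`,
`f₂ f₁ = f₁ a`, `f_{j+1} f_j = f_j f_{j-1}` for `j = 2, …, 2s-2`,
`g f_{2s-1} = f_{2s-1} f_{2s-2}` and `b g = g f_{2s-1}`,
where a relator `u = v` stands for the word `u * v⁻¹`. -/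
def wirtRels (s : ℕ) (hs : 3 ≤ s) : Set (FreeGroup (WirtGen s)) :=
  { wC s * wA s * (wA s * wD s)⁻¹, wA s * wC s * (wC s * wB s)⁻¹,
    wD s * wF s * (wF s * wE s)⁻¹, wF s * wE s * (wE s * wC s)⁻¹,
    wE s * wC s * (wC s * wG s)⁻¹,
    wf s 1 ⟨by omega, by omega⟩ * wA s * (wA s * wF s)⁻¹,
    wf s 2 ⟨by omega, by omega⟩ * wf s 1 ⟨by omega, by omega⟩ *
      (wf s 1 ⟨by omega, by omega⟩ * wA s)⁻¹,
    wG s * wf s (2 * s - 1) ⟨by omega, by omega⟩ *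
      (wf s (2 * s - 1) ⟨by omega, by omega⟩ * wf s (2 * s - 2) ⟨by omega, by omega⟩)⁻¹,
    wB s * wG s * (wG s * wf s (2 * s - 1) ⟨by omega, by omega⟩)⁻¹ } ∪
  { w | ∃ j : ℕ, ∃ h1 : 2 ≤ j, ∃ h2 : j ≤ 2 * s - 2,
      w = wf s (j + 1) ⟨by omega, by omega⟩ * wf s j ⟨by omega, by omega⟩ *
        (wf s j ⟨by omega, by omega⟩ * wf s (j - 1) ⟨by omega, by omega⟩)⁻¹ }

/-- The sequence `y₀ = f`, `y₁ = a`, `y_{n+2} = y_{n+1} y_n y_{n+1}⁻¹`. -/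
def ySeq {G : Type*} [Group G] (a f : G) : ℕ → G
  | 0 => f
  | 1 => a
  | (n + 2) => ySeq a f (n + 1) * ySeq a f n * (ySeq a f (n + 1))⁻¹

theorem ySeq_step {G : Type*} [Group G] (a f : G) (n : ℕ) :
    ySeq a f (n + 2) * ySeq a f (n + 1) = ySeq a f (n + 1) * ySeq a f n := by
  rw [ySeq]; group

theorem ySeq_prod {G : Type*} [Group G] (a f : G) (n : ℕ) :
    ySeq a f (n + 1) * ySeq a f n = a * f := by
  induction n with
  | zero => rfl
  | succ n ih => rw [ySeq_step, ih]

theorem ySeq_two {G : Type*} [Group G] (a f : G) (n : ℕ) :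
    ySeq a f (n + 2) = (a * f) * ySeq a f n * (a * f)⁻¹ := by
  rw [← ySeq_prod a f n, ySeq]; group

theorem ySeq_odd {G : Type*} [Group G] (a f : G) (m : ℕ) :
    ySeq a f (2 * m + 1) = (a * f) ^ m * a * ((a * f) ^ m)⁻¹ := by
  induction m with
  | zero => simp [ySeq]
  | succ m ih =>
    rw [show 2 * (m + 1) + 1 = (2 * m + 1) + 2 by ring, ySeq_two, ih, pow_succ']
    simp only [mul_inv_rev, mul_assoc]

theorem pretzelRel_map {G : Type*} [Group G] (φ : FreeGroup (Fin 2) →* G) (s : ℕ) (c l : G)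
    (hc : φ (FreeGroup.of 0) = c) (hl : φ (FreeGroup.of 1) = l) :
    φ (pretzelRel s) = c * l * c * l⁻¹ * c⁻¹ * (l ^ s)⁻¹ * c⁻¹ * l⁻¹ * c * l * c * (l ^ s * l⁻¹) := by
  simp only [pretzelRel, cw, lw, map_mul, map_inv, map_pow, hc, hl, zpow_neg, zpow_sub_one,
    zpow_natCast]

/-- The key word computation: the relator is equivalent to `e c = c g`. -/
theorem rel_iff {G : Type*} [Group G] (c l P : G) :
    c * l * c * l⁻¹ * c⁻¹ * P⁻¹ * c⁻¹ * l⁻¹ * c * l * c * (P * l⁻¹) = 1 ↔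
    (l⁻¹ * c * l) * c =
      c * (P * (c * l * c⁻¹ * l⁻¹ * c⁻¹ * l) * P⁻¹) := by
  have key : (l⁻¹ * c * l) * c * (c * (P * (c * l * c⁻¹ * l⁻¹ * c⁻¹ * l) * P⁻¹))⁻¹ =
      (c * l * c * l⁻¹ * c⁻¹ * P⁻¹ * c⁻¹)⁻¹ *
      (c * l * c * l⁻¹ * c⁻¹ * P⁻¹ * c⁻¹ * l⁻¹ * c * l * c * (P * l⁻¹)) *
      (c * l * c * l⁻¹ * c⁻¹ * P⁻¹ * c⁻¹)⁻¹⁻¹ := by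
    group
  rw [← mul_inv_eq_one (a := (l⁻¹ * c * l) * c), key, conj_eq_one_iff]

/-- Values of the Wirtinger generators in a group with elements `c`, `l`. -/
def wVal {G : Type*} [Group G] (s : ℕ) (c l : G) : WirtGen s → G :=
  let f := l⁻¹ * c * l * c * l⁻¹ * c⁻¹ * l
  let a := c * l * c⁻¹ * l⁻¹ * c⁻¹ * l
  Sum.elim ![a, ySeq a f (2 * s + 2), c, a⁻¹ * c * a, l⁻¹ * c * l, f, ySeq a f (2 * s + 1)]
    (fun j => ySeq a f (j.1 + 2))

theorem wVal_rel {G : Type*} [Group G] (s : ℕ) (hs : 3 ≤ s) (c l : G)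
    (h : c * l * c * l⁻¹ * c⁻¹ * (l ^ s)⁻¹ * c⁻¹ * l⁻¹ * c * l * c * (l ^ s * l⁻¹) = 1) :
    ∀ r ∈ wirtRels s hs, FreeGroup.lift (wVal s c l) r = 1 := by
  rw [rel_iff] at h
  obtain ⟨f, hf⟩ : ∃ f, f = l⁻¹ * c * l * c * l⁻¹ * c⁻¹ * l := ⟨_, rfl⟩
  obtain ⟨a, ha⟩ : ∃ a, a = c * l * c⁻¹ * l⁻¹ * c⁻¹ * l := ⟨_, rfl⟩
  have hv : wVal s c l = Sum.elim ![a, ySeq a f (2 * s + 2), c, a⁻¹ * c * a, l⁻¹ * c * l, f,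
      ySeq a f (2 * s + 1)] (fun j => ySeq a f (j.1 + 2)) := by
    subst hf ha; rfl
  have haf : a * f = l := by rw [ha, hf]; group
  have hg := ySeq_odd a f s
  have hbg := ySeq_prod a f (2 * s + 1)
  rw [haf] at hg hbg
  rw [← ha, ← hg] at h
  have hst := ySeq_step a f
  rw [hv]
  rintro r ((rfl | rfl | rfl | rfl | rfl | rfl | rfl | rfl | rfl) | ⟨j, h1, h2, rfl⟩) <;>
    simp only [wA, wB, wC, wD, wE, wF, wG, wf, map_mul, map_inv, FreeGroup.lift_apply_of,
      Sum.elim_inl, Sum.elim_inr, mul_inv_eq_one]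
  · change c * a = a * (a⁻¹ * c * a)
    group
  · change a * c = c * ySeq a f (2 * s + 2)
    rw [eq_mul_inv_of_mul_eq hbg, eq_inv_mul_of_mul_eq h.symm, ha]
    group
  · change a⁻¹ * c * a * f = f * (l⁻¹ * c * l)
    rw [← haf]; group
  · change f * (l⁻¹ * c * l) = l⁻¹ * c * l * c
    rw [hf]; group
  · exact h
  · exact hst 0
  · exact hst 1
  · change ySeq a f (2 * s + 1) * ySeq a f (2 * s - 1 - 1 + 2) =
      ySeq a f (2 * s - 1 - 1 + 2) * ySeq a f (2 * s - 2 - 1 + 2)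
    rw [show 2 * s - 1 - 1 + 2 = 2 * s by omega, show 2 * s - 2 - 1 + 2 = 2 * s - 1 by omega]
    have := hst (2 * s - 1)
    rwa [show 2 * s - 1 + 2 = 2 * s + 1 by omega, show 2 * s - 1 + 1 = 2 * s by omega] at this
  · change ySeq a f (2 * s + 2) * ySeq a f (2 * s + 1) =
      ySeq a f (2 * s + 1) * ySeq a f (2 * s - 1 - 1 + 2)
    rw [show 2 * s - 1 - 1 + 2 = 2 * s by omega]
    exact hst (2 * s)
  · obtain ⟨k, rfl⟩ : ∃ k, j = k + 2 := ⟨j - 2, by omega⟩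
    exact hst (k + 2)

/-- In any group where the Wirtinger relations hold, the generators are given by `wVal`, and the
one-relator relation holds. -/
theorem wirt_back {G : Type*} [Group G] (s : ℕ) (hs : 3 ≤ s) (φ : FreeGroup (WirtGen s) →* G)
    (h : ∀ r ∈ wirtRels s hs, φ r = 1) (c l : G) (hc : c = φ (wC s))
    (hl : l = φ (wA s) * φ (wF s)) :
    (∀ x, φ (FreeGroup.of x) = wVal s c l x) ∧
    c * l * c * l⁻¹ * c⁻¹ * (l ^ s)⁻¹ * c⁻¹ * l⁻¹ * c * l * c * (l ^ s * l⁻¹) = 1 := by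
  have h' : ∀ u v, u * v⁻¹ ∈ wirtRels s hs → φ u = φ v := fun u v hm => by
    have := h _ hm
    rwa [map_mul, map_inv, mul_inv_eq_one] at this
  have r1 := h' (wC s * wA s) (wA s * wD s) (by simp [wirtRels])
  have r2 := h' (wA s * wC s) (wC s * wB s) (by simp [wirtRels])
  have r3 := h' (wD s * wF s) (wF s * wE s) (by simp [wirtRels])
  have r4 := h' (wF s * wE s) (wE s * wC s) (by simp [wirtRels])
  have r5 := h' (wE s * wC s) (wC s * wG s) (by simp [wirtRels])
  have r6 := h' (wf s 1 ⟨by omega, by omega⟩ * wA s) (wA s * wF s) (by simp [wirtRels])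
  have r7 := h' (wf s 2 ⟨by omega, by omega⟩ * wf s 1 ⟨by omega, by omega⟩)
    (wf s 1 ⟨by omega, by omega⟩ * wA s) (by simp [wirtRels])
  have r8 := h' (wG s * wf s (2 * s - 1) ⟨by omega, by omega⟩)
    (wf s (2 * s - 1) ⟨by omega, by omega⟩ * wf s (2 * s - 2) ⟨by omega, by omega⟩)
    (by simp [wirtRels])
  have r9 := h' (wB s * wG s) (wG s * wf s (2 * s - 1) ⟨by omega, by omega⟩)
    (by simp [wirtRels])
  have r10 : ∀ j : ℕ, ∀ h1 : 2 ≤ j, ∀ h2 : j ≤ 2 * s - 2,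
      φ (wf s (j + 1) ⟨by omega, by omega⟩ * wf s j ⟨by omega, by omega⟩) =
        φ (wf s j ⟨by omega, by omega⟩ * wf s (j - 1) ⟨by omega, by omega⟩) :=
    fun j h1 h2 => h' _ _ (Or.inr ⟨j, h1, h2, rfl⟩)
  clear h h'
  simp only [map_mul] at *
  rw [← hc] at r1 r2 r4 r5
  obtain ⟨a, ha⟩ : ∃ a, a = φ (wA s) := ⟨_, rfl⟩
  obtain ⟨f, hf⟩ : ∃ f, f = φ (wF s) := ⟨_, rfl⟩
  obtain ⟨e, he⟩ : ∃ e, e = φ (wE s) := ⟨_, rfl⟩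
  obtain ⟨d, hd⟩ : ∃ d, d = φ (wD s) := ⟨_, rfl⟩
  obtain ⟨g, hg⟩ : ∃ g, g = φ (wG s) := ⟨_, rfl⟩
  obtain ⟨b, hb⟩ : ∃ b, b = φ (wB s) := ⟨_, rfl⟩
  simp only [← ha, ← hf, ← he, ← hd, ← hg, ← hb] at hl r1 r2 r3 r4 r5 r6 r7 r8 r9
  have hF : ∀ n : ℕ, ∀ hn : n + 1 < 2 * s - 1,
      φ (wf s (n + 1) ⟨by omega, by omega⟩) = ySeq a f (n + 2) ∧
      φ (wf s (n + 2) ⟨by omega, by omega⟩) = ySeq a f (n + 3) := by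
    intro n
    induction n with
    | zero =>
      intro hn
      have e1 : φ (wf s 1 ⟨by omega, by omega⟩) = ySeq a f 2 := eq_mul_inv_of_mul_eq r6
      refine ⟨e1, ?_⟩
      rw [e1] at r7
      exact eq_mul_inv_of_mul_eq r7
    | succ n ih =>
      intro hn
      obtain ⟨i1, i2⟩ := ih (by omega)
      refine ⟨i2, ?_⟩
      have := r10 (n + 2) (by omega) (by omega)
      simp only [show n + 2 - 1 = n + 1 by omega] at this
      rw [i1, i2] at this
      exact eq_mul_inv_of_mul_eq this
  obtain ⟨p1, p2⟩ := hF (2 * s - 3) (by omega)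
  simp only [show 2 * s - 3 + 1 = 2 * s - 2 by omega, show 2 * s - 3 + 2 = 2 * s - 1 by omega,
    show 2 * s - 3 + 3 = 2 * s by omega] at p1 p2
  rw [p1, p2] at r8
  rw [p2] at r9
  have hgy : g = ySeq a f (2 * s + 1) := by
    have := ySeq_step a f (2 * s - 1)
    rw [show 2 * s - 1 + 2 = 2 * s + 1 by omega, show 2 * s - 1 + 1 = 2 * s by omega, ← r8] at this
    exact (mul_right_cancel this).symm
  have hby : b = ySeq a f (2 * s + 2) := by
    rw [hgy] at r9
    exact eq_mul_inv_of_mul_eq r9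
  have hd' : d = a⁻¹ * c * a := by rw [mul_assoc]; exact eq_inv_mul_of_mul_eq r1.symm
  have he' : e = l⁻¹ * c * l := by
    have : e = f⁻¹ * (d * f) := eq_inv_mul_of_mul_eq r3.symm
    rw [this, hd', hl]; group
  have hf' : f = l⁻¹ * c * l * c * l⁻¹ * c⁻¹ * l := by
    have : f = e * c * e⁻¹ := eq_mul_inv_of_mul_eq r4
    rw [this, he']; group
  have ha' : a = c * l * c⁻¹ * l⁻¹ * c⁻¹ * l := by
    have : a = l * f⁻¹ := eq_mul_inv_of_mul_eq hl.symm
    rw [this, hf']; group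
  have hv : wVal s c l = Sum.elim ![a, ySeq a f (2 * s + 2), c, a⁻¹ * c * a, l⁻¹ * c * l, f,
      ySeq a f (2 * s + 1)] (fun j => ySeq a f (j.1 + 2)) := by
    unfold wVal; rw [← hf', ← ha']
  constructor
  · rw [hv]
    rintro (x | ⟨x, hx⟩)
    · fin_cases x
      · exact ha.symm
      · exact hb.symm.trans hby
      · exact hc.symm
      · exact hd.symm.trans hd'
      · exact he.symm.trans he'
      · exact hf.symm
      · exact hg.symm.trans hgy
    · by_cases hx2 : x + 1 < 2 * s - 1
      · exact (hF x hx2).1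
      · obtain rfl : x = 2 * s - 2 := by omega
        have := (hF (2 * s - 3) (by omega)).2
        simp only [show 2 * s - 3 + 2 = 2 * s - 2 + 1 by omega,
          show 2 * s - 3 + 3 = 2 * s - 2 + 2 by omega] at this
        exact this
  · rw [rel_iff, ← ha', ← he', r5, hgy, ySeq_odd, hl]

/-- The Wirtinger presentation of the knot group of the
`(-2,3,2s+1)`-pretzel knot is isomorphic to the two-generator one-relator
presentation `G_s`. -/
theorem wirtinger_iso_Gs (s : ℕ) (hs : 3 ≤ s) :
    Nonempty (PresentedGroup (wirtRels s hs) ≃* Gs (s : ℤ)) := by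
  let c : Gs (s : ℤ) := PresentedGroup.of 0
  let l : Gs (s : ℤ) := PresentedGroup.of 1
  have hR : c * l * c * l⁻¹ * c⁻¹ * (l ^ s)⁻¹ * c⁻¹ * l⁻¹ * c * l * c * (l ^ s * l⁻¹) = 1 := by
    rw [← pretzelRel_map (PresentedGroup.mk {pretzelRel (s : ℤ)}) s c l rfl rfl]
    exact PresentedGroup.one_of_mem (Set.mem_singleton _)
  let c' : PresentedGroup (wirtRels s hs) := PresentedGroup.of (Sum.inl 2)
  let a' : PresentedGroup (wirtRels s hs) := PresentedGroup.of (Sum.inl 0)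
  let f' : PresentedGroup (wirtRels s hs) := PresentedGroup.of (Sum.inl 5)
  obtain ⟨hgen, hR'⟩ := wirt_back s hs (PresentedGroup.mk (wirtRels s hs))
    (fun r hr => PresentedGroup.one_of_mem hr) c' (a' * f') rfl rfl
  let Φ : PresentedGroup (wirtRels s hs) →* Gs (s : ℤ) :=
    PresentedGroup.toGroup (wVal_rel s hs c l hR)
  let Ψ : Gs (s : ℤ) →* PresentedGroup (wirtRels s hs) :=
    PresentedGroup.toGroup (f := ![c', a' * f']) (by
      rintro r rfl
      rw [pretzelRel_map _ s c' (a' * f') (by simp) (by simp)]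
      exact hR')
  have hΨc : Ψ c = c' := PresentedGroup.toGroup.of _
  have hΨl : Ψ l = a' * f' := PresentedGroup.toGroup.of _
  have hΦ : ∀ x, Φ (PresentedGroup.of x) = wVal s c l x := fun x => PresentedGroup.toGroup.of _
  have hseq : ∀ (a f : Gs (s : ℤ)) n, Ψ (ySeq a f n) = ySeq (Ψ a) (Ψ f) n := by
    intro a f n
    induction n using Nat.twoStepInduction with
    | zero => rfl
    | one => rfl
    | more n h1 h2 => simp only [ySeq, map_mul, map_inv, h1, h2]
  have hval : ∀ x, Ψ (wVal s c l x) = wVal s c' (a' * f') x := by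
    rintro (x | x)
    · fin_cases x <;> simp [wVal, hseq, hΨc, hΨl]
    · simp [wVal, hseq, hΨc, hΨl]
  refine ⟨MonoidHom.toMulEquiv Φ Ψ ?_ ?_⟩
  · apply PresentedGroup.ext
    intro x
    change Ψ (Φ (PresentedGroup.of x)) = PresentedGroup.of x
    rw [hΦ, hval]
    exact (hgen x).symm
  · apply PresentedGroup.ext
    intro x
    fin_cases x
    · change Φ (Ψ c) = c
      rw [hΨc]
      exact hΦ _
    · change Φ (Ψ l) = l
      rw [hΨl, map_mul, hΦ, hΦ]
      change (c * l * c⁻¹ * l⁻¹ * c⁻¹ * l) * (l⁻¹ * c * l * c * l⁻¹ * c⁻¹ * l) = l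
      group
end

section
/- Let s ≥ 3 be an integer and let p, q be integers. Suppose G_s(p,q) acts (on the right) on the real line ℝ by order-preserving bijections such that x·c > x for every x ∈ ℝ and x·l > x for every x ∈ ℝ, where c and l denote the images of the generators. Then x·(l c l^s c l^s c l) > x·c³ for every x ∈ ℝ. -/
/-- Claim 1 in the proof of Proposition 3.5.
If `G_s(p,q)` acts on the right on `ℝ` by order-preserving bijections such that
`x·c > x` and `x·l > x` for every `x ∈ ℝ`, then
`x·(l c l^s c l^s c l) > x·c³` for every `x ∈ ℝ`. -/
theorem word_gt_c_cubed (s p q : ℤ) (hs : 3 ≤ s)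
    (act : ℝ → Gspq s p q → ℝ)
    (act_one : ∀ x : ℝ, act x 1 = x)
    (act_mul : ∀ (x : ℝ) (g h : Gspq s p q), act x (g * h) = act (act x g) h)
    (act_le : ∀ g : Gspq s p q, ∀ x y : ℝ, x ≤ y ↔ act x g ≤ act y g)
    (hc : ∀ x : ℝ, x < act x (PresentedGroup.mk _ cw))
    (hl : ∀ x : ℝ, x < act x (PresentedGroup.mk _ lw)) :
    ∀ x : ℝ,
      act x (PresentedGroup.mk _
          (lw * cw * lw ^ s * cw * lw ^ s * cw * lw)) >
        act x (PresentedGroup.mk _ (cw ^ (3 : ℤ))) := by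
  intro x
  obtain ⟨n, rfl⟩ := Int.eq_ofNat_of_zero_le (by omega : (0 : ℤ) ≤ s)
  have hpow : ∀ (m : ℕ) (y : ℝ), y ≤ act y ((PresentedGroup.mk _ lw) ^ m) := by
    intro m
    induction m with
    | zero => intro y; rw [pow_zero, act_one]
    | succ k ih =>
      intro y
      rw [pow_succ, act_mul]
      exact (ih y).trans (hl _).le
  have hcm : ∀ y z : ℝ, y ≤ z →
      act y (PresentedGroup.mk _ cw) ≤ act z (PresentedGroup.mk _ cw) :=
    fun y z h => (act_le _ y z).1 h
  have e3 : (cw ^ (3 : ℤ) : FreeGroup (Fin 2)) = cw * cw * cw := by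
    rw [show (3 : ℤ) = ((3 : ℕ) : ℤ) from rfl, zpow_natCast, pow_succ, pow_two]
  rw [e3]
  simp only [map_mul, map_zpow, Int.ofNat_eq_natCast, zpow_natCast, map_pow, act_mul, gt_iff_lt]
  refine lt_of_le_of_lt ?_ (hl _)
  exact hcm _ _ ((hcm _ _ ((hcm _ _ (hl x).le).trans (hpow n _))).trans (hpow n _))
end
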